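/- Let 0<α<n, 1<p<q<∞, and let (u,σ) be a pair of weights on ℝ^n. Then there exist constants c,C>0 depending only on n, α, p and q such that c·(‖M_α(·σ)‖_{L^p(σ)→L^{q}(u)} + ‖M_α(·u)‖_{L^{q'}(u)→L^{p'}(σ)}) ≤ ‖I_α(·σ)‖_{L^p(σ)→L^{q}(u)} ≤ C·(‖M_α(·σ)‖_{L^p(σ)→L^{q}(u)} + ‖M_α(·u)‖_{L^{q'}(u)→L^{p'}(σ)}); i.e., the strong (p,q) operator norm of the Riesz potential I_α(·σ) is comparable to the sum of the two strong operator norms of the fractional maximal operator. -/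

import Mathlib

open MeasureTheory ENNReal Set

noncomputable section

/-- `ℝ^n` with Lebesgue measure. -/
abbrev Rn (n : ℕ) : Type := Fin n → ℝ

/-- An axis-parallel (half-open) cube in `ℝ^n`. -/
structure Cube (n : ℕ) where
  corner : Fin n → ℝ
  side : ℝ
  side_pos : 0 < side

/-- The underlying set of a cube. -/
def Cube.set {n : ℕ} (Q : Cube n) : Set (Rn n) :=
  {x | ∀ i, Q.corner i ≤ x i ∧ x i < Q.corner i + Q.side}

/-- The volume `|Q|` of a cube. -/
def Cube.vol {n : ℕ} (Q : Cube n) : ℝ := Q.side ^ n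

/-- Conjugate exponent `p' = p/(p-1)`. -/
def conjExp (p : ℝ) : ℝ := p / (p - 1)

/-- Average over a cube of an `ℝ≥0∞`-valued function. -/
def avgE {n : ℕ} (Q : Cube n) (g : Rn n → ℝ≥0∞) : ℝ≥0∞ :=
  (∫⁻ x in Q.set, g x) / ENNReal.ofReal Q.vol

/-- Average over a cube of a (nonnegative) real weight. -/
def avgW {n : ℕ} (Q : Cube n) (w : Rn n → ℝ) : ℝ≥0∞ :=
  avgE Q fun x => ENNReal.ofReal (w x)

/-- Weighted `L^p` norm `‖f‖_{L^p(w)}` of an `ℝ≥0∞`-valued function. -/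
def LpW {n : ℕ} (f : Rn n → ℝ≥0∞) (p : ℝ) (w : Rn n → ℝ) : ℝ≥0∞ :=
  (∫⁻ x, f x ^ p * ENNReal.ofReal (w x)) ^ (1 / p)

/-- Weighted weak `L^q` quasinorm `‖f‖_{L^{q,∞}(w)}`. -/
def WeakLpW {n : ℕ} (f : Rn n → ℝ≥0∞) (q : ℝ) (w : Rn n → ℝ) : ℝ≥0∞ :=
  ⨆ (t : ℝ) (_ : 0 < t),
    ENNReal.ofReal t *
      (∫⁻ x in {x | ENNReal.ofReal t < f x}, ENNReal.ofReal (w x)) ^ (1 / q)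

/-- The fractional maximal operator `M_α`. -/
def fracMax {n : ℕ} (α : ℝ) (f : Rn n → ℝ≥0∞) (x : Rn n) : ℝ≥0∞ :=
  ⨆ (Q : Cube n) (_ : x ∈ Q.set),
    ENNReal.ofReal (Q.vol ^ (α / n - 1)) * ∫⁻ y in Q.set, f y

/-- The Euclidean norm on `ℝ^n`. -/
def eucNorm {n : ℕ} (x : Rn n) : ℝ := Real.sqrt (∑ i, x i ^ 2)

/-- The Riesz potential `I_α`. -/
def riesz {n : ℕ} (α : ℝ) (f : Rn n → ℝ≥0∞) (x : Rn n) : ℝ≥0∞ :=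
  ∫⁻ y, f y * ENNReal.ofReal (eucNorm (x - y) ^ (α - n))

/-- The product `fσ` of an `ℝ≥0∞`-valued function with a weight. -/
def mulW {n : ℕ} (f : Rn n → ℝ≥0∞) (w : Rn n → ℝ) : Rn n → ℝ≥0∞ :=
  fun x => f x * ENNReal.ofReal (w x)

/-- The operator norm `‖T(·σ)‖_{L^p(σ) → L^q(u)}` (least admissible constant). -/
def opNormStrong {n : ℕ} (T : (Rn n → ℝ≥0∞) → Rn n → ℝ≥0∞) (p q : ℝ)
    (σ u : Rn n → ℝ) : ℝ≥0∞ :=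
  ⨆ (f : Rn n → ℝ≥0∞) (_ : Measurable f), LpW (T (mulW f σ)) q u / LpW f p σ

/-- The weak-type operator norm `‖T(·σ)‖_{L^p(σ) → L^{q,∞}(u)}`. -/
def opNormWeak {n : ℕ} (T : (Rn n → ℝ≥0∞) → Rn n → ℝ≥0∞) (p q : ℝ)
    (σ u : Rn n → ℝ) : ℝ≥0∞ :=
  ⨆ (f : Rn n → ℝ≥0∞) (_ : Measurable f), WeakLpW (T (mulW f σ)) q u / LpW f p σ

/-- The operator norm `‖T‖_{L^p(v) → L^q(u)}` (no multiplication by the weight). -/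
def opNormPlain {n : ℕ} (T : (Rn n → ℝ≥0∞) → Rn n → ℝ≥0∞) (p q : ℝ)
    (v u : Rn n → ℝ) : ℝ≥0∞ :=
  ⨆ (f : Rn n → ℝ≥0∞) (_ : Measurable f), LpW (T f) q u / LpW f p v

/-- The weak-type operator norm `‖T‖_{L^p(v) → L^{q,∞}(u)}`. -/
def opNormPlainWeak {n : ℕ} (T : (Rn n → ℝ≥0∞) → Rn n → ℝ≥0∞) (p q : ℝ)
    (v u : Rn n → ℝ) : ℝ≥0∞ :=
  ⨆ (f : Rn n → ℝ≥0∞) (_ : Measurable f), WeakLpW (T f) q u / LpW f p v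

/-- A weight: a nonnegative locally integrable (measurable) function. -/
def IsWeight {n : ℕ} (w : Rn n → ℝ) : Prop :=
  Measurable w ∧ (∀ x, 0 ≤ w x) ∧ LocallyIntegrable w volume

/-- The local `A^α_{p,q}` functional `A^α_{p,q}(u,σ,Q)`. -/
def ApqQ {n : ℕ} (α p q : ℝ) (u σ : Rn n → ℝ) (Q : Cube n) : ℝ≥0∞ :=
  ENNReal.ofReal (Q.vol ^ (α / n + 1 / q - 1 / p)) * avgW Q u ^ (1 / q) *
    avgW Q σ ^ (1 / conjExp p)

/-- The joint constant `[u,σ]_{A^α_{p,q}}`. -/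
def Apq {n : ℕ} (α p q : ℝ) (u σ : Rn n → ℝ) : ℝ≥0∞ :=
  ⨆ Q : Cube n, ApqQ α p q u σ Q

/-- `A^α_{p,q}` for `ℝ≥0∞`-valued weights. -/
def ApqE {n : ℕ} (α p q : ℝ) (u σ : Rn n → ℝ≥0∞) : ℝ≥0∞ :=
  ⨆ Q : Cube n,
    ENNReal.ofReal (Q.vol ^ (α / n + 1 / q - 1 / p)) * avgE Q u ^ (1 / q) *
      avgE Q σ ^ (1 / conjExp p)

/-- Real-valued average over a cube. -/
def avgR {n : ℕ} (Q : Cube n) (w : Rn n → ℝ) : ℝ := (∫ x in Q.set, w x) / Q.vol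

/-- The local exponential `A_∞` functional `A^{exp}_∞(w,Q)`. -/
def AexpQ {n : ℕ} (Q : Cube n) (w : Rn n → ℝ) : ℝ :=
  avgR Q w * Real.exp (- avgR Q fun x => Real.log (w x))

/-- `w ∈ A_∞` (exponential definition). -/
def IsAinf {n : ℕ} (w : Rn n → ℝ) : Prop :=
  ∃ C : ℝ, ∀ Q : Cube n,
    IntegrableOn (fun x => Real.log (w x)) Q.set volume ∧ AexpQ Q w ≤ C

/-- The local Fujii–Wilson functional `A^M_∞(w,Q) = w(Q)⁻¹ ∫_Q M(wχ_Q)`. -/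
def FWQ {n : ℕ} (Q : Cube n) (w : Rn n → ℝ) : ℝ≥0∞ :=
  (∫⁻ x in Q.set, fracMax 0 (Q.set.indicator fun y => ENNReal.ofReal (w y)) x) /
    ∫⁻ x in Q.set, ENNReal.ofReal (w x)

/-- The Fujii–Wilson constant `[w]_{A^M_∞}`. -/
def FW {n : ℕ} (w : Rn n → ℝ) : ℝ≥0∞ := ⨆ Q : Cube n, FWQ Q w

/-- The local Muckenhoupt `A_r` functional. -/
def ArQ {n : ℕ} (r : ℝ) (v : Rn n → ℝ) (Q : Cube n) : ℝ≥0∞ :=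
  avgW Q v * (avgE Q fun x => ENNReal.ofReal (v x) ^ (1 - conjExp r)) ^ (r - 1)

/-- The Muckenhoupt constant `[v]_{A_r}`. -/
def ArC {n : ℕ} (r : ℝ) (v : Rn n → ℝ) : ℝ≥0∞ := ⨆ Q : Cube n, ArQ r v Q

/-- The mixed constant `[v]_{(A_r)^β (A^M_∞)^γ}`. -/
def mixedC {n : ℕ} (r β γ : ℝ) (v : Rn n → ℝ) : ℝ≥0∞ :=
  ⨆ Q : Cube n, ArQ r v Q ^ β * FWQ Q v ^ γ

/-- `Φ(t) = 1 + log t` applied to an `ℝ≥0∞` constant. -/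
def PhiLog (X : ℝ≥0∞) : ℝ≥0∞ :=
  if X = ∞ then ∞ else ENNReal.ofReal (1 + Real.log X.toReal)

/-- A Young function. -/
def IsYoung (Φ : ℝ → ℝ) : Prop :=
  ContinuousOn Φ (Ici 0) ∧ ConvexOn ℝ (Ici 0) Φ ∧ StrictMonoOn Φ (Ici 0) ∧
    Φ 0 = 0 ∧ Filter.Tendsto (fun t => Φ t / t) Filter.atTop Filter.atTop

/-- The associate (conjugate) Young function `Φ̄(t) = sup_{s>0} (st - Φ(s))`. -/
def assocFn (Φ : ℝ → ℝ) (t : ℝ) : ℝ :=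
  sSup {y : ℝ | ∃ s : ℝ, 0 < s ∧ y = s * t - Φ s}

/-- The localized Luxemburg average `‖f‖_{Φ,Q}`. -/
def luxNorm {n : ℕ} (Φ : ℝ → ℝ) (Q : Cube n) (f : Rn n → ℝ) : ℝ≥0∞ :=
  sInf ((fun l : ℝ => ENNReal.ofReal l) ''
    {l : ℝ | 0 < l ∧
      (∫⁻ x in Q.set, ENNReal.ofReal (Φ (|f x| / l))) ≤ ENNReal.ofReal Q.vol})

/-- The fractional Orlicz maximal operator `M_{β,Φ}`. -/
def orliczMax {n : ℕ} (β : ℝ) (Φ : ℝ → ℝ) (f : Rn n → ℝ) (x : Rn n) : ℝ≥0∞ :=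
  ⨆ (Q : Cube n) (_ : x ∈ Q.set), ENNReal.ofReal (Q.vol ^ (β / n)) * luxNorm Φ Q f

/-- Unweighted `L^p` norm of a real function. -/
def Lp0 {n : ℕ} (f : Rn n → ℝ) (p : ℝ) : ℝ≥0∞ :=
  (∫⁻ x, ENNReal.ofReal |f x| ^ p) ^ (1 / p)

/-- Unweighted `L^p` norm of an `ℝ≥0∞`-valued function. -/
def LpE {n : ℕ} (g : Rn n → ℝ≥0∞) (p : ℝ) : ℝ≥0∞ :=
  (∫⁻ x, g x ^ p) ^ (1 / p)

/-- The unweighted operator norm `‖M_{β,Φ}‖_{L^p → L^q}`. -/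
def orliczMaxNorm (n : ℕ) (β : ℝ) (Φ : ℝ → ℝ) (p q : ℝ) : ℝ≥0∞ :=
  ⨆ (f : Rn n → ℝ) (_ : Measurable f), LpE (orliczMax β Φ f) q / Lp0 f p

/-- The `B^β_p` integral `∫_c^∞ Φ(t)^{q/p} t^{-q} dt/t`, where `1/q = 1/p - β/n`. -/
def BInt (Φ : ℝ → ℝ) (p q : ℝ) (c : ℝ) : ℝ≥0∞ :=
  ∫⁻ t in Ioi c, ENNReal.ofReal (Φ t ^ (q / p) * t ^ (-q) / t)

/-- The `B^β_p` condition (with `q` given by `1/q = 1/p - β/n`). -/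
def BCond (Φ : ℝ → ℝ) (p q : ℝ) : Prop := ∃ c : ℝ, 0 < c ∧ BInt Φ p q c < ∞

/-- The bump constant `[u,σ]_{A^α_{p,q,Φ}}`. -/
def bumpA {n : ℕ} (α p q : ℝ) (Φ : ℝ → ℝ) (u σ : Rn n → ℝ) : ℝ≥0∞ :=
  ⨆ Q : Cube n,
    ENNReal.ofReal (Q.vol ^ (α / n + 1 / q - 1 / p)) * avgW Q u ^ (1 / q) *
      luxNorm Φ Q (fun x => σ x ^ (1 / conjExp p))

/-- A dyadic grid in `ℝ^n`. -/
def IsDyadicGrid {n : ℕ} (D : Set (Cube n)) : Prop :=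
  (∀ Q ∈ D, ∃ k : ℤ, Q.side = (2 : ℝ) ^ k) ∧
  (∀ Q ∈ D, ∀ P ∈ D, Q.set ∩ P.set = P.set ∨ Q.set ∩ P.set = Q.set ∨
    Q.set ∩ P.set = ∅) ∧
  (∀ k : ℤ, ∀ x : Rn n, ∃! Q : Cube n, Q ∈ D ∧ Q.side = (2 : ℝ) ^ k ∧ x ∈ Q.set)

/-- The outer dyadic Riesz potential `I_α^{Q₀}`. -/
def outerRiesz {n : ℕ} (D : Set (Cube n)) (α : ℝ) (Q₀ : Cube n)
    (f : Rn n → ℝ≥0∞) (x : Rn n) : ℝ≥0∞ :=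
  ∑' Q : {Q : Cube n // Q ∈ D ∧ Q₀.set ⊆ Q.set},
    Q.1.set.indicator
      (fun _ => ENNReal.ofReal (Q.1.vol ^ (α / n - 1)) * ∫⁻ y in Q.1.set, f y) x

/-- The outer testing constant `[u,σ]_{I_α^{out},p,q}`. -/
def outerTest {n : ℕ} (D : Set (Cube n)) (α p q : ℝ) (u σ : Rn n → ℝ) : ℝ≥0∞ :=
  ⨆ (Q₀ : Cube n) (_ : Q₀ ∈ D),
    (∫⁻ x, outerRiesz D α Q₀ (Q₀.set.indicator fun y => ENNReal.ofReal (σ y)) x ^ q *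
        ENNReal.ofReal (u x)) ^ (1 / q) /
      (∫⁻ x in Q₀.set, ENNReal.ofReal (σ x)) ^ (1 / p)

/-- The dyadic fractional maximal operator `M_α^𝒟`. -/
def dyadicFracMax {n : ℕ} (D : Set (Cube n)) (α : ℝ) (f : Rn n → ℝ≥0∞)
    (x : Rn n) : ℝ≥0∞ :=
  ⨆ (Q : Cube n) (_ : Q ∈ D) (_ : x ∈ Q.set),
    ENNReal.ofReal (Q.vol ^ (α / n - 1)) * ∫⁻ y in Q.set, f y

/-- A sparse family `S ⊆ D` with associated disjoint thick subsets `E Q ⊆ Q`. -/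
def IsSparse {n : ℕ} (D S : Set (Cube n)) (E : Cube n → Set (Rn n)) : Prop :=
  S ⊆ D ∧
  (∀ Q ∈ S, E Q ⊆ Q.set ∧ MeasurableSet (E Q) ∧
    ENNReal.ofReal Q.vol ≤ 2 * volume (E Q)) ∧
  S.PairwiseDisjoint E

/-- The sparse operator `L_α^S`. -/
def sparseOp {n : ℕ} (S : Set (Cube n)) (E : Cube n → Set (Rn n)) (α : ℝ)
    (f : Rn n → ℝ≥0∞) (x : Rn n) : ℝ≥0∞ :=
  ∑' Q : S,
    (E Q.1).indicator
      (fun _ => ENNReal.ofReal (Q.1.vol ^ (α / n - 1)) * ∫⁻ y in Q.1.set, f y) x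

/-- The one-dimensional fractional maximal operator over bounded intervals. -/
def fm1 (γ : ℝ) (f : ℝ → ℝ≥0∞) (x : ℝ) : ℝ≥0∞ :=
  ⨆ (a : ℝ) (b : ℝ) (_ : a < b) (_ : x ∈ Icc a b),
    ENNReal.ofReal ((b - a) ^ (γ - 1)) * ∫⁻ y in Ioo a b, f y

/-- The integer part of the binary logarithm. -/
def lev (x : ℝ) : ℤ := ⌊Real.logb 2 x⌋

lemma two_rpow_lev_le {x : ℝ} (hx : 0 < x) : (2 : ℝ) ^ (lev x : ℝ) ≤ x := by
  rw [← Real.le_logb_iff_rpow_le (by norm_num) hx]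
  exact Int.floor_le _

lemma lt_two_rpow_lev {x : ℝ} (hx : 0 < x) : x < 2 * (2 : ℝ) ^ (lev x : ℝ) := by
  have : x < (2 : ℝ) ^ ((lev x : ℝ) + 1) := by
    rw [← Real.logb_lt_iff_lt_rpow (by norm_num) hx]
    exact Int.lt_floor_add_one _
  rw [Real.rpow_add (by norm_num), Real.rpow_one] at this
  linarith

lemma le_two_mul_of_lev_eq {x y : ℝ} (hx : 0 < x) (hy : 0 < y) (h : lev x = lev y) :
    x ≤ 2 * y := by
  have h1 := lt_two_rpow_lev hx
  have h2 := two_rpow_lev_le hy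
  rw [h] at h1
  linarith

lemma lev_mono {x y : ℝ} (hx : 0 < x) (h : x ≤ y) : lev x ≤ lev y :=
  Int.floor_le_floor (Real.logb_le_logb_of_le (by norm_num) hx h)

lemma exists_geometric_sum_le {ε : ℝ} (hε : 0 < ε) : ∃ C : ℝ, 0 < C ∧
    ∀ (E : Finset ℤ) (x : ℝ), 0 ≤ x → (∀ t ∈ E, (2 : ℝ) ^ (t : ℝ) ≤ x) →
      ∑ t ∈ E, (2 : ℝ) ^ ((t : ℝ) * ε) ≤ C * x ^ ε := by
  have hr0 : (0 : ℝ) < 2 ^ (-ε) := by positivity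
  have hr1 : (2 : ℝ) ^ (-ε) < 1 := Real.rpow_lt_one_of_one_lt_of_neg (by norm_num) (by linarith)
  refine ⟨(1 - 2 ^ (-ε))⁻¹, inv_pos.2 (by linarith), fun E x hx0 hx => ?_⟩
  rcases E.eq_empty_or_nonempty with rfl | hE
  · simp only [Finset.sum_empty]
    exact mul_nonneg (inv_nonneg.2 (by linarith)) (Real.rpow_nonneg hx0 _)
  set m := E.max' hE with hm
  have key : ∀ t ∈ E, (2 : ℝ) ^ ((t : ℝ) * ε) =
      (2 : ℝ) ^ ((m : ℝ) * ε) * (2 ^ (-ε)) ^ (m - t).toNat := by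
    intro t ht
    have h : 0 ≤ m - t := by have := E.le_max' t ht; omega
    rw [← Real.rpow_natCast, ← Real.rpow_mul (by norm_num), ← Real.rpow_add (by norm_num)]
    congr 1
    have : (((m - t).toNat : ℤ) : ℝ) = (m : ℝ) - t := by rw [Int.toNat_of_nonneg h]; push_cast; ring
    have h2 : (((m - t).toNat : ℕ) : ℝ) = (m : ℝ) - t := by exact_mod_cast this
    rw [h2]; ring
  rw [Finset.sum_congr rfl key, ← Finset.mul_sum]
  have hinj : Set.InjOn (fun t => (m - t).toNat) (E : Set ℤ) := by
    intro a ha b hb hab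
    have h1 := E.le_max' a ha
    have h2 := E.le_max' b hb
    simp only at hab
    omega
  rw [← Finset.sum_image (f := fun j : ℕ => ((2 : ℝ) ^ (-ε)) ^ j) hinj]
  have hs := (summable_geometric_of_lt_one hr0.le hr1).sum_le_tsum
    (E.image fun t => (m - t).toNat) (fun i _ => by positivity)
  rw [tsum_geometric_of_lt_one hr0.le hr1] at hs
  have hm2 : (2 : ℝ) ^ ((m : ℝ) * ε) ≤ x ^ ε := by
    rw [Real.rpow_mul (by norm_num)]
    exact Real.rpow_le_rpow (by positivity) (hx m (E.max'_mem hE)) hε.le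
  rw [mul_comm]
  exact mul_le_mul hs hm2 (by positivity) (inv_nonneg.2 (by linarith))

/-- Dyadic weak-type information for the averages `F` of a function in `L^p` of a measure with
masses `σ`: the sets `{F ≥ 2 ^ k}` have mass at most `V k`, and `∑ 2 ^ (k p) V k ≤ K`. -/
def LevelBound {ι : Type*} [PartialOrder ι] (T : Finset ι) (σ F : ι → ℝ) (p K : ℝ)
    (V : ℤ → ℝ) : Prop :=
  (∀ k : ℤ, ∀ T' ⊆ T, IsAntichain (· ≤ ·) (T' : Set ι) →
    (∀ Q ∈ T', (2 : ℝ) ^ (k : ℝ) ≤ F Q) → ∑ Q ∈ T', σ Q ≤ V k) ∧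
  ∀ E : Finset ℤ, ∑ k ∈ E, (2 : ℝ) ^ ((k : ℝ) * p) * V k ≤ K

namespace LevelBound

variable {ι : Type*} [PartialOrder ι] {T : Finset ι} {σ F : ι → ℝ} {p K : ℝ} {V : ℤ → ℝ}

lemma subset (h : LevelBound T σ F p K V) {T' : Finset ι} (hT : T' ⊆ T) :
    LevelBound T' σ F p K V :=
  ⟨fun k S hS => h.1 k S (hS.trans hT), h.2⟩

lemma nonneg (h : LevelBound T σ F p K V) (k : ℤ) : 0 ≤ V k := by
  simpa using h.1 k ∅ (Finset.empty_subset _) (by simp) (by simp)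

lemma antichain_sum_le (h : LevelBound T σ F p K V) (hσ : ∀ Q ∈ T, 0 ≤ σ Q)
    (hF : ∀ Q ∈ T, 0 < F Q) (hp : 0 < p) (k : ℤ) (hT : IsAntichain (· ≤ ·) (T : Set ι))
    (hk : ∀ Q ∈ T, lev (F Q) = k) :
    ∑ Q ∈ T, σ Q * F Q ^ p ≤ 2 ^ p * (2 ^ ((k : ℝ) * p) * V k) := by
  have h1 := h.1 k T subset_rfl hT (fun Q hQ => by
    have := two_rpow_lev_le (hF Q hQ); rwa [hk Q hQ] at this)
  calc ∑ Q ∈ T, σ Q * F Q ^ p ≤ ∑ Q ∈ T, σ Q * (2 * 2 ^ (k : ℝ)) ^ p := by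
        refine Finset.sum_le_sum fun Q hQ => mul_le_mul_of_nonneg_left ?_ (hσ Q hQ)
        have := lt_two_rpow_lev (hF Q hQ)
        rw [hk Q hQ] at this
        exact Real.rpow_le_rpow (hF Q hQ).le this.le hp.le
    _ = (∑ Q ∈ T, σ Q) * (2 ^ p * 2 ^ ((k : ℝ) * p)) := by
        rw [← Finset.sum_mul, Real.mul_rpow (by norm_num) (by positivity),
          ← Real.rpow_mul (by norm_num)]
    _ ≤ V k * (2 ^ p * 2 ^ ((k : ℝ) * p)) := by gcongr
    _ = _ := by ring

lemma sum_le (h : LevelBound T σ F p K V) (hσ : ∀ Q ∈ T, 0 ≤ σ Q)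
    (hF : ∀ Q ∈ T, 0 < F Q) (hp : 0 < p)
    (hT : ∀ Q ∈ T, ∀ Q' ∈ T, Q ≤ Q' → lev (F Q) = lev (F Q') → Q = Q') :
    ∑ Q ∈ T, σ Q * F Q ^ p ≤ 2 ^ p * K := by
  classical
  rw [← Finset.sum_fiberwise_of_maps_to (t := T.image fun Q => lev (F Q))
    (g := fun Q => lev (F Q)) (fun Q hQ => Finset.mem_image_of_mem _ hQ)]
  calc _ ≤ ∑ k ∈ T.image fun Q => lev (F Q), 2 ^ p * (2 ^ ((k : ℝ) * p) * V k) := by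
        refine Finset.sum_le_sum fun k _ => ?_
        refine (h.subset (Finset.filter_subset _ _)).antichain_sum_le
          (fun Q hQ => hσ Q (Finset.mem_filter.1 hQ).1)
          (fun Q hQ => hF Q (Finset.mem_filter.1 hQ).1) hp k ?_
          (fun Q hQ => (Finset.mem_filter.1 hQ).2)
        intro Q hQ Q' hQ' hne hle
        have hQ := Finset.mem_filter.1 (Finset.mem_coe.1 hQ)
        have hQ' := Finset.mem_filter.1 (Finset.mem_coe.1 hQ')
        exact hne (hT Q hQ.1 Q' hQ'.1 hle (hQ.2.trans hQ'.2.symm))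
    _ ≤ 2 ^ p * K := by
        rw [← Finset.mul_sum]
        exact mul_le_mul_of_nonneg_left (h.2 _) (by positivity)

end LevelBound

open scoped Classical in
/-- If each element of `T` dominates an element of `M`, a sum over `T` is bounded by a double sum
over `M` and its upper bounds. -/
lemma sum_le_sum_upper {ι : Type*} [PartialOrder ι] {T M : Finset ι} {x : ι → ℝ}
    {y : ι → ι → ℝ} (hy : ∀ Q' ∈ M, ∀ Q ∈ T, 0 ≤ y Q Q')
    (h : ∀ Q ∈ T, ∃ Q' ∈ M, Q' ≤ Q ∧ x Q ≤ y Q Q') :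
    ∑ Q ∈ T, x Q ≤ ∑ Q' ∈ M, ∑ Q ∈ T with Q' ≤ Q, y Q Q' := by
  simp_rw [Finset.sum_filter]
  rw [Finset.sum_comm]
  refine Finset.sum_le_sum fun Q hQ => ?_
  obtain ⟨Q', hQ', hle, hxy⟩ := h Q hQ
  refine hxy.trans ?_
  have := Finset.single_le_sum (f := fun Q' => if Q' ≤ Q then y Q Q' else 0) (s := M)
    (fun i hi => by split_ifs; exacts [hy i hi Q hQ, le_rfl]) hQ'
  simpa [hle] using this

lemma mass_le_of_lev_eq {p s s' F F' : ℝ} (hp : 0 < p) (hs : 0 < s) (hs' : 0 < s') (hF : 0 < F)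
    (hF' : 0 < F') (h : lev F = lev F') (ha : lev (s * F ^ p) = lev (s' * F' ^ p)) :
    s ≤ 2 ^ (1 + p) * s' := by
  have h1 := le_two_mul_of_lev_eq (by positivity) (by positivity) ha
  have h2 : F' ^ p ≤ 2 ^ p * F ^ p := by
    rw [← Real.mul_rpow (by norm_num) hF.le]
    exact Real.rpow_le_rpow hF'.le (le_two_mul_of_lev_eq hF' hF h.symm) hp.le
  have h3 : s * F ^ p ≤ (2 ^ (1 + p) * s') * F ^ p := by
    calc s * F ^ p ≤ 2 * (s' * F' ^ p) := h1
      _ ≤ 2 * (s' * (2 ^ p * F ^ p)) := by gcongr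
      _ = _ := by rw [Real.rpow_add (by norm_num), Real.rpow_one]; ring
  exact le_of_mul_le_mul_right h3 (by positivity)

open scoped Classical in
lemma tail_sum_le {ι : Type*} [PartialOrder ι] {T : Finset ι} {σ F u l : ι → ℝ} {p q e K : ℝ}
    {V : ℤ → ℝ} (hp : 0 < p) (he : 0 ≤ e) (hσ : ∀ Q ∈ T, 0 < σ Q) (hF : ∀ Q ∈ T, 0 < F Q)
    (hu : ∀ Q ∈ T, 0 < u Q) (hl : ∀ Q ∈ T, 0 < l Q) (hV : LevelBound T σ F p K V)
    (hA : ∀ Q ∈ T, (∑ R ∈ T with Q ≤ R, l R ^ q * u R) * σ Q ^ e ≤ 1)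
    {s : ℤ} (hs : ∀ Q ∈ T, lev (σ Q * F Q ^ p) = s) :
    ∑ Q ∈ T, l Q ^ q * u Q * σ Q ^ e * (σ Q * F Q ^ p) ≤
      2 * (2 ^ (1 + p)) ^ e * (2 ^ p * K) := by
  set M := T.filter fun Q => ∀ Q' ∈ T, Q' ≤ Q → lev (F Q') = lev (F Q) → Q' = Q with hM
  have hMT : M ⊆ T := Finset.filter_subset _ _
  set c : ℝ := (2 ^ (1 + p)) ^ e with hc
  have hc0 : 0 < c := by positivity
  have step : ∑ Q ∈ T, l Q ^ q * u Q * σ Q ^ e * (σ Q * F Q ^ p) ≤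
      ∑ Q' ∈ M, ∑ Q ∈ T with Q' ≤ Q,
        (l Q ^ q * u Q) * (2 * c * σ Q' ^ e * (σ Q' * F Q' ^ p)) := by
    refine sum_le_sum_upper ?_ ?_
    · intro Q' hQ' Q hQ
      have := hσ Q' (hMT hQ'); have := hF Q' (hMT hQ'); have := hu Q hQ; have := hl Q hQ
      positivity
    · intro Q hQ
      obtain ⟨Q', hle, hmin⟩ := Finset.exists_le_minimal
        (T.filter fun R => lev (F R) = lev (F Q)) (a := Q) (by simp [hQ])
      obtain ⟨hQ'T, hQ'l⟩ := Finset.mem_filter.1 hmin.prop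
      refine ⟨Q', Finset.mem_filter.2 ⟨hQ'T, fun R hR hRle hRl => ?_⟩, hle, ?_⟩
      · exact hRle.antisymm (hmin.2 (Finset.mem_filter.2 ⟨hR, hRl.trans hQ'l⟩) hRle)
      · have := hσ Q' hQ'T; have := hF Q' hQ'T; have := hu Q hQ; have := hl Q hQ
        have := hσ Q hQ; have := hF Q hQ
        have ha : lev (σ Q * F Q ^ p) = lev (σ Q' * F Q' ^ p) := by rw [hs Q hQ, hs Q' hQ'T]
        have h1 := le_two_mul_of_lev_eq (by positivity) (by positivity) ha
        have h2 : σ Q ^ e ≤ c * σ Q' ^ e := by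
          rw [hc, ← Real.mul_rpow (by positivity) (by positivity)]
          exact Real.rpow_le_rpow (by positivity)
            (mass_le_of_lev_eq hp (hσ Q hQ) (hσ Q' hQ'T) (hF Q hQ) (hF Q' hQ'T) hQ'l.symm ha) he
        calc l Q ^ q * u Q * σ Q ^ e * (σ Q * F Q ^ p)
            ≤ l Q ^ q * u Q * (c * σ Q' ^ e) * (2 * (σ Q' * F Q' ^ p)) := by gcongr
          _ = _ := by ring
  refine step.trans ?_
  have hcarl := (hV.subset hMT).sum_le (fun Q hQ => (hσ Q (hMT hQ)).le)
    (fun Q hQ => hF Q (hMT hQ)) hp (fun Q hQ Q' hQ' hle hl =>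
      (Finset.mem_filter.1 hQ').2 Q (hMT hQ) hle hl)
  calc _ ≤ ∑ Q' ∈ M, 2 * c * (σ Q' * F Q' ^ p) := by
        refine Finset.sum_le_sum fun Q' hQ' => ?_
        rw [← Finset.sum_mul]
        have := hσ Q' (hMT hQ'); have := hF Q' (hMT hQ')
        calc _ = ((∑ R ∈ T with Q' ≤ R, l R ^ q * u R) * σ Q' ^ e) *
              (2 * c * (σ Q' * F Q' ^ p)) := by ring
          _ ≤ 1 * (2 * c * (σ Q' * F Q' ^ p)) := by
              gcongr; exact hA Q' (hMT hQ')
          _ = _ := one_mul _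
    _ = 2 * c * ∑ Q' ∈ M, (σ Q' * F Q' ^ p) := by rw [Finset.mul_sum]
    _ ≤ _ := by gcongr

/-- Carleson-type bound with a loss: `∑ u G ^ r` over a family in which `σ F ^ p` has size
`2 ^ s` and which is an antichain for fixed sizes of `G` and `u G ^ r`. -/
lemma exists_lossy_sum_le {p r K ε : ℝ} (hp : 0 < p) (hr : 0 < r) (hK : 0 < K) (hε : 0 < ε)
    (hε1 : ε < 1) : ∃ C : ℝ, 0 < C ∧ ∀ {ι : Type} [PartialOrder ι] (T : Finset ι)
      (σ F u G : ι → ℝ) (V U : ℤ → ℝ) (s : ℤ), (∀ Q ∈ T, 0 < σ Q) → (∀ Q ∈ T, 0 < F Q) →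
      (∀ Q ∈ T, 0 < u Q) → (∀ Q ∈ T, 0 < G Q) → LevelBound T σ F p K V →
      LevelBound T u G r K U → (∀ Q ∈ T, lev (σ Q * F Q ^ p) = s) →
      (∀ Q ∈ T, ∀ Q' ∈ T, Q ≤ Q' → lev (u Q * G Q ^ r) = lev (u Q' * G Q' ^ r) →
        lev (G Q) = lev (G Q') → Q = Q') →
      ∑ Q ∈ T, u Q * G Q ^ r ≤ C * (2 : ℝ) ^ (-((s : ℝ) * ε)) := by
  classical
  obtain ⟨C₀, hC₀, hgeo⟩ := exists_geometric_sum_le hε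
  refine ⟨2 * (2 ^ p * K) ^ ε * C₀ * (2 ^ r * K), by positivity, ?_⟩
  intro ι _ T σ F u G V U s hσ hF hu hG hV hU hs hT
  -- the contribution of fixed sizes of `G` and `u G ^ r`
  have hfix : ∀ m t : ℤ, ∑ Q ∈ T with lev (G Q) = m ∧ lev (u Q * G Q ^ r) = t, u Q * G Q ^ r ≤
      2 * (2 ^ p * K) ^ ε * (2 : ℝ) ^ (-((s : ℝ) * ε)) *
        (2 ^ r * (2 ^ ((m : ℝ) * r) * U m)) ^ (1 - ε) * (2 : ℝ) ^ ((t : ℝ) * ε) := by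
    intro m t
    set R := T.filter fun Q => lev (G Q) = m ∧ lev (u Q * G Q ^ r) = t with hR
    have hRT : R ⊆ T := Finset.filter_subset _ _
    have hanti : ∀ Q ∈ R, ∀ Q' ∈ R, Q ≤ Q' → Q = Q' := by
      intro Q hQ Q' hQ' hle
      have h1 := Finset.mem_filter.1 hQ
      have h2 := Finset.mem_filter.1 hQ'
      exact hT Q h1.1 Q' h2.1 hle (h1.2.2.trans h2.2.2.symm) (h1.2.1.trans h2.2.1.symm)
    have hb1 := (hV.subset hRT).sum_le (fun Q hQ => (hσ Q (hRT hQ)).le)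
      (fun Q hQ => hF Q (hRT hQ)) hp (fun Q hQ Q' hQ' hle _ => hanti Q hQ Q' hQ' hle)
    have hb2 := (hU.subset hRT).antichain_sum_le (fun Q hQ => (hu Q (hRT hQ)).le)
      (fun Q hQ => hG Q (hRT hQ)) hr m
      (fun Q hQ Q' hQ' hne hle => hne (hanti Q hQ Q' hQ' hle))
      (fun Q hQ => (Finset.mem_filter.1 hQ).2.1)
    have hn1 : (R.card : ℝ) * (2 : ℝ) ^ (s : ℝ) ≤ 2 ^ p * K := by
      refine le_trans ?_ hb1
      rw [← nsmul_eq_mul]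
      refine Finset.card_nsmul_le_sum _ _ _ fun Q hQ => ?_
      have h := hs Q (hRT hQ)
      have := hσ Q (hRT hQ); have := hF Q (hRT hQ)
      rw [← h]
      exact two_rpow_lev_le (by positivity)
    have hn2 : (R.card : ℝ) * (2 : ℝ) ^ (t : ℝ) ≤ 2 ^ r * (2 ^ ((m : ℝ) * r) * U m) := by
      refine le_trans ?_ hb2
      rw [← nsmul_eq_mul]
      refine Finset.card_nsmul_le_sum _ _ _ fun Q hQ => ?_
      have h := (Finset.mem_filter.1 hQ).2.2
      have := hu Q (hRT hQ); have := hG Q (hRT hQ)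
      rw [← h]
      exact two_rpow_lev_le (by positivity)
    have hsum : ∑ Q ∈ R, u Q * G Q ^ r ≤ R.card * (2 * (2 : ℝ) ^ (t : ℝ)) := by
      rw [← nsmul_eq_mul]
      refine Finset.sum_le_card_nsmul _ _ _ fun Q hQ => ?_
      have h := (Finset.mem_filter.1 hQ).2.2
      have := hu Q (hRT hQ); have := hG Q (hRT hQ)
      rw [← h]
      exact (lt_two_rpow_lev (by positivity)).le
    have hU0 := hU.nonneg m
    set N : ℝ := (R.card : ℝ)
    have hN : 0 ≤ N := Nat.cast_nonneg _
    have e1 : N * (2 : ℝ) ^ (t : ℝ) = (N * (2 : ℝ) ^ (s : ℝ)) ^ ε *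
        (N * (2 : ℝ) ^ (t : ℝ)) ^ (1 - ε) * (2 : ℝ) ^ (-((s : ℝ) * ε)) *
        (2 : ℝ) ^ ((t : ℝ) * ε) := by
      rw [Real.mul_rpow hN (by positivity), Real.mul_rpow hN (by positivity),
        ← Real.rpow_mul (by norm_num), ← Real.rpow_mul (by norm_num)]
      have h1 : N ^ ε * N ^ (1 - ε) = N := by
        rw [← Real.rpow_add_of_nonneg hN hε.le (by linarith), add_sub_cancel, Real.rpow_one]
      have h2 : (2 : ℝ) ^ ((s : ℝ) * ε) * 2 ^ ((t : ℝ) * (1 - ε)) * (2 : ℝ) ^ (-((s : ℝ) * ε)) *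
        (2 : ℝ) ^ ((t : ℝ) * ε) = 2 ^ (t : ℝ) := by
        rw [← Real.rpow_add (by norm_num), ← Real.rpow_add (by norm_num),
          ← Real.rpow_add (by norm_num)]
        congr 1; ring
      calc N * (2 : ℝ) ^ (t : ℝ) = (N ^ ε * N ^ (1 - ε)) * ((2 : ℝ) ^ ((s : ℝ) * ε) *
            2 ^ ((t : ℝ) * (1 - ε)) * (2 : ℝ) ^ (-((s : ℝ) * ε)) * (2 : ℝ) ^ ((t : ℝ) * ε)) := by
            rw [h1, h2]
        _ = _ := by ring
    calc ∑ Q ∈ R, u Q * G Q ^ r ≤ 2 * (N * (2 : ℝ) ^ (t : ℝ)) := by linarith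
      _ = 2 * ((N * (2 : ℝ) ^ (s : ℝ)) ^ ε *
        (N * (2 : ℝ) ^ (t : ℝ)) ^ (1 - ε) * (2 : ℝ) ^ (-((s : ℝ) * ε)) *
        (2 : ℝ) ^ ((t : ℝ) * ε)) := by rw [← e1]
      _ ≤ 2 * ((2 ^ p * K) ^ ε *
        (2 ^ r * (2 ^ ((m : ℝ) * r) * U m)) ^ (1 - ε) * (2 : ℝ) ^ (-((s : ℝ) * ε)) *
        (2 : ℝ) ^ ((t : ℝ) * ε)) := by
          have : 0 ≤ 1 - ε := by linarith
          clear e1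
          gcongr
      _ = _ := by ring
  -- the contribution of a fixed size of `G`
  have hfix' : ∀ m : ℤ, ∑ Q ∈ T with lev (G Q) = m, u Q * G Q ^ r ≤
      2 * (2 ^ p * K) ^ ε * (2 : ℝ) ^ (-((s : ℝ) * ε)) * C₀ *
        (2 ^ r * (2 ^ ((m : ℝ) * r) * U m)) := by
    intro m
    set R := T.filter fun Q => lev (G Q) = m with hR
    have hRT : R ⊆ T := Finset.filter_subset _ _
    have hU0 := hU.nonneg m
    set β : ℝ := 2 ^ r * (2 ^ ((m : ℝ) * r) * U m) with hβ
    have hβ0 : 0 ≤ β := by positivity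
    set b : ι → ℤ := fun Q => lev (u Q * G Q ^ r) with hbdef
    rw [← Finset.sum_fiberwise_of_maps_to (t := R.image b) (g := b)
      (fun Q hQ => Finset.mem_image_of_mem _ hQ)]
    have hE : ∀ t ∈ R.image b, (2 : ℝ) ^ (t : ℝ) ≤ β := by
      intro t ht
      obtain ⟨Q, hQ, rfl⟩ := Finset.mem_image.1 ht
      have := hu Q (hRT hQ); have := hG Q (hRT hQ)
      refine (two_rpow_lev_le (by positivity)).trans ?_
      have := (hU.subset (Finset.singleton_subset_iff.2 (hRT hQ))).antichain_sum_le
        (fun Q' hQ' => by rw [Finset.mem_singleton.1 hQ']; exact (hu Q (hRT hQ)).le)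
        (fun Q' hQ' => by rw [Finset.mem_singleton.1 hQ']; exact hG Q (hRT hQ)) hr m
        (by simp) (fun Q' hQ' => by
          rw [Finset.mem_singleton.1 hQ']; exact (Finset.mem_filter.1 hQ).2)
      simpa using this
    calc _ ≤ ∑ t ∈ R.image b, 2 * (2 ^ p * K) ^ ε * (2 : ℝ) ^ (-((s : ℝ) * ε)) *
        β ^ (1 - ε) * (2 : ℝ) ^ ((t : ℝ) * ε) := by
          refine Finset.sum_le_sum fun t _ => ?_
          rw [hR, Finset.filter_filter]
          exact hfix m t
      _ = 2 * (2 ^ p * K) ^ ε * (2 : ℝ) ^ (-((s : ℝ) * ε)) *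
        β ^ (1 - ε) * ∑ t ∈ R.image b, (2 : ℝ) ^ ((t : ℝ) * ε) := by rw [Finset.mul_sum]
      _ ≤ 2 * (2 ^ p * K) ^ ε * (2 : ℝ) ^ (-((s : ℝ) * ε)) *
        β ^ (1 - ε) * (C₀ * β ^ ε) := by
          gcongr
          exact hgeo _ _ hβ0 hE
      _ = 2 * (2 ^ p * K) ^ ε * (2 : ℝ) ^ (-((s : ℝ) * ε)) * C₀ *
        (β ^ (1 - ε) * β ^ ε) := by ring
      _ = _ := by
          rw [← Real.rpow_add_of_nonneg hβ0 (by linarith) hε.le]; simp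
  rw [← Finset.sum_fiberwise_of_maps_to (t := T.image fun Q => lev (G Q))
    (g := fun Q => lev (G Q)) (fun Q hQ => Finset.mem_image_of_mem _ hQ)]
  calc _ ≤ ∑ m ∈ T.image fun Q => lev (G Q), 2 * (2 ^ p * K) ^ ε * (2 : ℝ) ^ (-((s : ℝ) * ε)) * C₀ *
        (2 ^ r * (2 ^ ((m : ℝ) * r) * U m)) := Finset.sum_le_sum fun m _ => hfix' m
    _ = 2 * (2 ^ p * K) ^ ε * (2 : ℝ) ^ (-((s : ℝ) * ε)) * C₀ *
        2 ^ r * ∑ m ∈ T.image fun Q => lev (G Q), (2 ^ ((m : ℝ) * r) * U m) := by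
          rw [Finset.mul_sum]; refine Finset.sum_congr rfl fun m _ => by ring
    _ ≤ 2 * (2 ^ p * K) ^ ε * (2 : ℝ) ^ (-((s : ℝ) * ε)) * C₀ * 2 ^ r * K := by
          gcongr; exact hU.2 _
    _ = _ := by ring

lemma term_factorization {p q r l s u F G : ℝ} (hp : 0 < p) (hqr : q.HolderConjugate r)
    (hl : 0 < l) (hs : 0 < s) (hu : 0 < u) (hF : 0 < F) (hG : 0 < G) :
    l * s * u * F * G = (l ^ q * u * s ^ (q * (1 - 1 / p)) * (s * F ^ p)) ^ (1 / q) *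
      (u * G ^ r) ^ (1 / r) * (s * F ^ p) ^ (1 / p - 1 / q) := by
  have hq := hqr.pos
  have hr := hqr.symm.pos
  apply Real.log_injOn_pos
  · exact Set.mem_Ioi.2 (by positivity)
  · exact Set.mem_Ioi.2 (by positivity)
  have e1 : Real.log (l * s * u * F * G) =
      Real.log l + Real.log s + Real.log u + Real.log F + Real.log G := by
    rw [Real.log_mul (by positivity) (by positivity), Real.log_mul (by positivity) (by positivity),
      Real.log_mul (by positivity) (by positivity), Real.log_mul (by positivity) (by positivity)]
  have ea : Real.log (s * F ^ p) = Real.log s + p * Real.log F := by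
    rw [Real.log_mul (by positivity) (by positivity), Real.log_rpow hF]
  have eb : Real.log (u * G ^ r) = Real.log u + r * Real.log G := by
    rw [Real.log_mul (by positivity) (by positivity), Real.log_rpow hG]
  have ex : Real.log (l ^ q * u * s ^ (q * (1 - 1 / p)) * (s * F ^ p)) =
      q * Real.log l + Real.log u + q * (1 - 1 / p) * Real.log s +
        (Real.log s + p * Real.log F) := by
    rw [Real.log_mul (by positivity) (by positivity), Real.log_mul (by positivity) (by positivity),
      Real.log_mul (by positivity) (by positivity), ea, Real.log_rpow hl, Real.log_rpow hs]
  rw [e1, Real.log_mul (by positivity) (by positivity), Real.log_mul (by positivity)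
    (by positivity), Real.log_rpow (by positivity), Real.log_rpow (by positivity),
    Real.log_rpow (by positivity), ea, eb, ex]
  have hr1 : r⁻¹ = 1 - q⁻¹ := by have := hqr.inv_add_inv_eq_one; linarith
  have h3 : 1 / r * (Real.log u + r * Real.log G) = (1 - q⁻¹) * Real.log u + Real.log G := by
    rw [← hr1]; field_simp
  rw [h3]
  field_simp
  ring

open scoped Classical in
/-- Half of the bilinear estimate: the family is sparse with respect to the second weight. -/
lemma exists_sparse_bilinear_le {p q r K : ℝ} (hp : 1 < p) (hpq : p < q)
    (hqr : q.HolderConjugate r) (hK : 0 < K) :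
    ∃ C : ℝ, 0 < C ∧ ∀ {ι : Type} [PartialOrder ι] (T : Finset ι)
      (σ F u G l : ι → ℝ) (V U : ℤ → ℝ), (∀ Q ∈ T, 0 < σ Q) → (∀ Q ∈ T, 0 < F Q) →
      (∀ Q ∈ T, 0 < u Q) → (∀ Q ∈ T, 0 < G Q) → (∀ Q ∈ T, 0 < l Q) →
      LevelBound T σ F p K V → LevelBound T u G r K U →
      (∀ Q ∈ T, (∑ R ∈ T with Q ≤ R, l R ^ q * u R) * σ Q ^ (q * (1 - 1 / p)) ≤ 1) →
      (∀ Q ∈ T, ∀ Q' ∈ T, Q ≤ Q' → lev (σ Q * F Q ^ p) = lev (σ Q' * F Q' ^ p) →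
        lev (u Q * G Q ^ r) = lev (u Q' * G Q' ^ r) → lev (G Q) = lev (G Q') → Q = Q') →
      ∑ Q ∈ T, l Q * σ Q * u Q * F Q * G Q ≤ C := by
  have hp0 : 0 < p := by linarith
  have hq0 : 0 < q := by linarith
  have hr0 : 0 < r := hqr.symm.pos
  set δ : ℝ := 1 / p - 1 / q with hδ
  have hδ0 : 0 < δ := by
    have := one_div_lt_one_div_of_lt hp0 hpq
    linarith
  have hδ1 : δ < 1 := by
    have h1 : 1 / p < 1 := by rw [div_lt_one hp0]; exact hp
    have h2 : 0 < 1 / q := by positivity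
    linarith
  obtain ⟨C₂, hC₂, hlossy⟩ := exists_lossy_sum_le (p := p) (r := r) hp0 hr0 hK hδ0 hδ1
  obtain ⟨C₀, hC₀, hgeo⟩ := exists_geometric_sum_le (ε := δ / q) (by positivity)
  set e : ℝ := q * (1 - 1 / p) with he
  have he0 : 0 ≤ e := by
    have h1 : 1 / p < 1 := by rw [div_lt_one hp0]; exact hp
    have : 0 ≤ 1 - 1 / p := by linarith
    positivity
  obtain ⟨C₁, hC₁⟩ : ∃ C₁ : ℝ, C₁ = 2 * (2 ^ (1 + p)) ^ e * (2 ^ p * K) := ⟨_, rfl⟩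
  have hC₁0 : 0 < C₁ := by rw [hC₁]; positivity
  refine ⟨2 ^ δ * C₁ ^ (1 / q) * C₂ ^ (1 / r) * (C₀ * (2 ^ p * K) ^ (δ / q)), by positivity, ?_⟩
  intro ι _ T σ F u G l V U hσ hF hu hG hl hV hU hA hT
  set a : ι → ℤ := fun Q => lev (σ Q * F Q ^ p) with ha
  have hfix : ∀ s : ℤ, ∑ Q ∈ T with a Q = s, l Q * σ Q * u Q * F Q * G Q ≤
      2 ^ δ * C₁ ^ (1 / q) * C₂ ^ (1 / r) * (2 : ℝ) ^ ((s : ℝ) * (δ / q)) := by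
    intro s
    set R := T.filter fun Q => a Q = s with hR
    have hRT : R ⊆ T := Finset.filter_subset _ _
    have hRs : ∀ Q ∈ R, lev (σ Q * F Q ^ p) = s := fun Q hQ => (Finset.mem_filter.1 hQ).2
    have hX := tail_sum_le (T := R) (q := q) hp0 he0 (fun Q hQ => hσ Q (hRT hQ))
      (fun Q hQ => hF Q (hRT hQ)) (fun Q hQ => hu Q (hRT hQ)) (fun Q hQ => hl Q (hRT hQ))
      (hV.subset hRT) (fun Q hQ => by
        refine le_trans ?_ (hA Q (hRT hQ))
        have := hσ Q (hRT hQ)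
        refine mul_le_mul_of_nonneg_right ?_ (by positivity)
        refine Finset.sum_le_sum_of_subset_of_nonneg (Finset.filter_subset_filter _ hRT) ?_
        intro P hP _
        have hP := (Finset.mem_filter.1 hP).1
        have := hl P hP; have := hu P hP
        positivity) hRs
    rw [← hC₁] at hX
    have hb := hlossy R σ F u G V U s (fun Q hQ => hσ Q (hRT hQ)) (fun Q hQ => hF Q (hRT hQ))
      (fun Q hQ => hu Q (hRT hQ)) (fun Q hQ => hG Q (hRT hQ)) (hV.subset hRT) (hU.subset hRT)
      hRs (fun Q hQ Q' hQ' hle => hT Q (hRT hQ) Q' (hRT hQ') hle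
        ((hRs Q hQ).trans (hRs Q' hQ').symm))
    have hpos : ∀ Q ∈ R, 0 ≤ l Q ^ q * u Q * σ Q ^ e * (σ Q * F Q ^ p) ∧ 0 ≤ u Q * G Q ^ r := by
      intro Q hQ
      have := hσ Q (hRT hQ); have := hF Q (hRT hQ); have := hu Q (hRT hQ)
      have := hG Q (hRT hQ); have := hl Q (hRT hQ)
      constructor <;> positivity
    have hH := Real.inner_le_Lp_mul_Lq_of_nonneg R hqr
      (f := fun Q => (l Q ^ q * u Q * σ Q ^ e * (σ Q * F Q ^ p)) ^ (1 / q))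
      (g := fun Q => (u Q * G Q ^ r) ^ (1 / r))
      (fun Q hQ => Real.rpow_nonneg (hpos Q hQ).1 _) (fun Q hQ => Real.rpow_nonneg (hpos Q hQ).2 _)
    have hs1 : ∑ Q ∈ R, ((l Q ^ q * u Q * σ Q ^ e * (σ Q * F Q ^ p)) ^ (1 / q)) ^ q =
        ∑ Q ∈ R, l Q ^ q * u Q * σ Q ^ e * (σ Q * F Q ^ p) := by
      refine Finset.sum_congr rfl fun Q hQ => ?_
      rw [← Real.rpow_mul (hpos Q hQ).1, one_div_mul_cancel hq0.ne', Real.rpow_one]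
    have hs2 : ∑ Q ∈ R, ((u Q * G Q ^ r) ^ (1 / r)) ^ r = ∑ Q ∈ R, u Q * G Q ^ r := by
      refine Finset.sum_congr rfl fun Q hQ => ?_
      rw [← Real.rpow_mul (hpos Q hQ).2, one_div_mul_cancel hr0.ne', Real.rpow_one]
    rw [hs1, hs2] at hH
    have hX0 := Finset.sum_nonneg fun Q hQ => (hpos Q hQ).1
    have hb0 := Finset.sum_nonneg fun Q hQ => (hpos Q hQ).2
    calc ∑ Q ∈ R, l Q * σ Q * u Q * F Q * G Q
        ≤ ∑ Q ∈ R, (l Q ^ q * u Q * σ Q ^ e * (σ Q * F Q ^ p)) ^ (1 / q) *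
            (u Q * G Q ^ r) ^ (1 / r) * (2 * (2 : ℝ) ^ (s : ℝ)) ^ δ := by
          refine Finset.sum_le_sum fun Q hQ => ?_
          have hh1 := hσ Q (hRT hQ)
          have hh2 := hF Q (hRT hQ)
          rw [term_factorization hp0 hqr (hl Q (hRT hQ)) hh1 (hu Q (hRT hQ)) hh2
            (hG Q (hRT hQ))]
          have h3 := lt_two_rpow_lev (show 0 < σ Q * F Q ^ p by positivity)
          rw [hRs Q hQ] at h3
          refine mul_le_mul_of_nonneg_left (Real.rpow_le_rpow (by positivity) h3.le hδ0.le) ?_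
          exact mul_nonneg (Real.rpow_nonneg (hpos Q hQ).1 _) (Real.rpow_nonneg (hpos Q hQ).2 _)
      _ ≤ (C₁ ^ (1 / q) * (C₂ * (2 : ℝ) ^ (-((s : ℝ) * δ))) ^ (1 / r)) *
            (2 * (2 : ℝ) ^ (s : ℝ)) ^ δ := by
          rw [← Finset.sum_mul]
          refine mul_le_mul_of_nonneg_right (hH.trans ?_) (by positivity)
          exact mul_le_mul (Real.rpow_le_rpow hX0 hX (by positivity))
            (Real.rpow_le_rpow hb0 hb (by positivity)) (Real.rpow_nonneg hb0 _) (by positivity)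
      _ = _ := by
          rw [Real.mul_rpow hC₂.le (by positivity), Real.mul_rpow (by norm_num) (by positivity),
            ← Real.rpow_mul (by norm_num), ← Real.rpow_mul (by norm_num)]
          have : (2 : ℝ) ^ ((s : ℝ) * (δ / q)) =
              (2 : ℝ) ^ (-((s : ℝ) * δ) * (1 / r)) * 2 ^ ((s : ℝ) * δ) := by
            rw [← Real.rpow_add (by norm_num)]
            congr 1
            have hr1 : 1 / r = 1 - q⁻¹ := by
              have := hqr.inv_add_inv_eq_one; rw [one_div]; linarith
            rw [hr1]; ring
          rw [this]; ring
  rw [← Finset.sum_fiberwise_of_maps_to (t := T.image a)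
    (g := a) (fun Q hQ => Finset.mem_image_of_mem _ hQ)]
  have hE : ∀ s ∈ T.image a, (2 : ℝ) ^ (s : ℝ) ≤ 2 ^ p * K := by
    intro s hs
    obtain ⟨Q, hQ, rfl⟩ := Finset.mem_image.1 hs
    have := hσ Q hQ; have := hF Q hQ
    refine (two_rpow_lev_le (by positivity)).trans ?_
    have := (hV.subset (Finset.singleton_subset_iff.2 hQ)).sum_le
      (fun Q' hQ' => by rw [Finset.mem_singleton.1 hQ']; exact (hσ Q hQ).le)
      (fun Q' hQ' => by rw [Finset.mem_singleton.1 hQ']; exact hF Q hQ) hp0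
      (fun Q₁ h₁ Q₂ h₂ _ _ => by rw [Finset.mem_singleton.1 h₁, Finset.mem_singleton.1 h₂])
    simpa using this
  refine (Finset.sum_le_sum fun s _ => hfix s).trans ?_
  rw [← Finset.mul_sum]
  exact mul_le_mul_of_nonneg_left (hgeo _ _ (by positivity) hE) (by positivity)

open scoped Classical in
/-- The bilinear estimate for a finite forest: two tail testing conditions imply boundedness. -/
lemma exists_bilinear_le {p q p' r K : ℝ} (hp : 1 < p) (hpq : p < q)
    (hpp : p.HolderConjugate p') (hqr : q.HolderConjugate r) (hK : 0 < K) :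
    ∃ C : ℝ, 0 < C ∧ ∀ {ι : Type} [PartialOrder ι] (S : Finset ι)
      (σ F u G l : ι → ℝ) (V U : ℤ → ℝ), (∀ Q ∈ S, 0 < σ Q) → (∀ Q ∈ S, 0 < F Q) →
      (∀ Q ∈ S, 0 < u Q) → (∀ Q ∈ S, 0 < G Q) → (∀ Q ∈ S, 0 < l Q) →
      (∀ Q ∈ S, ∀ R ∈ S, ∀ P ∈ S, Q ≤ R → Q ≤ P → R ≤ P ∨ P ≤ R) →
      (∀ Q ∈ S, ∀ R ∈ S, Q ≤ R → F R ≤ F Q) → (∀ Q ∈ S, ∀ R ∈ S, Q ≤ R → G R ≤ G Q) →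
      (∀ Q ∈ S, ∑ R ∈ S with Q ≤ R, l R ≤ K * l Q) →
      LevelBound S σ F p K V → LevelBound S u G r K U →
      (∀ Q ∈ S, (∑ R ∈ S with Q ≤ R, l R ^ q * u R) * σ Q ^ (q * (1 - 1 / p)) ≤ 1) →
      (∀ Q ∈ S, (∑ R ∈ S with Q ≤ R, l R ^ p' * σ R) * u Q ^ (p' * (1 - 1 / r)) ≤ 1) →
      ∑ Q ∈ S, l Q * σ Q * u Q * F Q * G Q ≤ C := by
  have hp0 : 0 < p := by linarith
  have hr0 : 0 < r := hqr.symm.pos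
  have hrp : r < p' := by
    have h1 := hpp.inv_add_inv_eq_one
    have h2 := hqr.inv_add_inv_eq_one
    have h3 := inv_strictAnti₀ hp0 hpq
    exact (inv_lt_inv₀ hpp.symm.pos hr0).1 (by linarith)
  obtain ⟨C₁, hC₁, h1⟩ := exists_sparse_bilinear_le hp hpq hqr hK
  obtain ⟨C₂, hC₂, h2⟩ := exists_sparse_bilinear_le hqr.symm.lt hrp hpp.symm hK
  set c : ℝ := 2 ^ (1 + p) * 2 ^ (1 + r) * 4 with hc
  have hc0 : 0 < c := by positivity
  refine ⟨c * K * (C₁ + C₂), by positivity, ?_⟩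
  intro ι _ S σ F u G l V U hσ hF hu hG hl htree hFmono hGmono hlsum hV hU hA hB
  set a : ι → ℤ := fun Q => lev (σ Q * F Q ^ p) with ha
  set b : ι → ℤ := fun Q => lev (u Q * G Q ^ r) with hb
  set k : ι → ℤ := fun Q => lev (F Q) with hk
  set m : ι → ℤ := fun Q => lev (G Q) with hm
  set M := S.filter fun Q => ∀ Q' ∈ S, Q' ≤ Q → a Q' = a Q → b Q' = b Q → k Q' = k Q →
    m Q' = m Q → Q' = Q with hM
  have hMS : M ⊆ S := Finset.filter_subset _ _
  have step : ∑ Q ∈ S, l Q * σ Q * u Q * F Q * G Q ≤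
      ∑ Q' ∈ M, ∑ Q ∈ S with Q' ≤ Q, l Q * (c * (σ Q' * u Q' * F Q' * G Q')) := by
    refine sum_le_sum_upper ?_ ?_
    · intro Q' hQ' Q hQ
      have := hσ Q' (hMS hQ'); have := hF Q' (hMS hQ'); have := hu Q' (hMS hQ')
      have := hG Q' (hMS hQ'); have := hl Q hQ
      positivity
    · intro Q hQ
      obtain ⟨Q', hle, hmin⟩ := Finset.exists_le_minimal
        (S.filter fun R => a R = a Q ∧ b R = b Q ∧ k R = k Q ∧ m R = m Q) (a := Q) (by simp [hQ])
      obtain ⟨hQ'S, ea, eb, ek, em⟩ := Finset.mem_filter.1 hmin.prop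
      refine ⟨Q', Finset.mem_filter.2 ⟨hQ'S, fun R hR hRle r1 r2 r3 r4 => ?_⟩, hle, ?_⟩
      · exact hRle.antisymm (hmin.2 (Finset.mem_filter.2
          ⟨hR, r1.trans ea, r2.trans eb, r3.trans ek, r4.trans em⟩) hRle)
      · have := hσ Q hQ; have := hF Q hQ; have := hu Q hQ; have := hG Q hQ; have := hl Q hQ
        have := hσ Q' hQ'S; have := hF Q' hQ'S; have := hu Q' hQ'S; have := hG Q' hQ'S
        have s1 := mass_le_of_lev_eq hp0 (hσ Q hQ) (hσ Q' hQ'S) (hF Q hQ) (hF Q' hQ'S)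
          ek.symm ea.symm
        have s2 := mass_le_of_lev_eq hr0 (hu Q hQ) (hu Q' hQ'S) (hG Q hQ) (hG Q' hQ'S)
          em.symm eb.symm
        have s3 := le_two_mul_of_lev_eq (hF Q hQ) (hF Q' hQ'S) ek.symm
        have s4 := le_two_mul_of_lev_eq (hG Q hQ) (hG Q' hQ'S) em.symm
        calc l Q * σ Q * u Q * F Q * G Q
            ≤ l Q * (2 ^ (1 + p) * σ Q') * (2 ^ (1 + r) * u Q') * (2 * F Q') * (2 * G Q') := by
              gcongr
          _ = _ := by rw [hc]; ring
  set M₁ := M.filter fun Q => ∀ R ∈ S, Q ≤ R → a R = a Q → b R = b Q → m R = m Q → k R = k Q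
    with hM₁
  set M₂ := M.filter fun Q => ∀ R ∈ S, Q ≤ R → b R = b Q → a R = a Q → k R = k Q → m R = m Q
    with hM₂
  have hM₁S : M₁ ⊆ S := (Finset.filter_subset _ _).trans hMS
  have hM₂S : M₂ ⊆ S := (Finset.filter_subset _ _).trans hMS
  have hcover : M ⊆ M₁ ∪ M₂ := by
    intro Q hQ
    by_contra hcon
    simp only [hM₁, hM₂, Finset.mem_union, Finset.mem_filter, hQ, true_and, not_or] at hcon
    push Not at hcon
    obtain ⟨⟨R, hR, hQR, ra, rb, rm, rk⟩, P, hP, hQP, pb, pa, pk, pm⟩ := hcon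
    have hkR : k R ≤ k Q := lev_mono (hF R hR) (hFmono Q (hMS hQ) R hR hQR)
    have hmP : m P ≤ m Q := lev_mono (hG P hP) (hGmono Q (hMS hQ) P hP hQP)
    rcases htree Q (hMS hQ) R hR P hP hQR hQP with h | h
    · have : k P ≤ k R := lev_mono (hF P hP) (hFmono R hR P hP h)
      omega
    · have : m R ≤ m P := lev_mono (hG R hR) (hGmono P hP R hR h)
      omega
  have hpos : ∀ Q ∈ S, 0 ≤ l Q * σ Q * u Q * F Q * G Q := by
    intro Q hQ
    have := hσ Q hQ; have := hF Q hQ; have := hu Q hQ; have := hG Q hQ; have := hl Q hQ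
    positivity
  have b1 : ∑ Q ∈ M₁, l Q * σ Q * u Q * F Q * G Q ≤ C₁ := by
    refine h1 M₁ σ F u G l V U (fun Q h => hσ Q (hM₁S h)) (fun Q h => hF Q (hM₁S h))
      (fun Q h => hu Q (hM₁S h)) (fun Q h => hG Q (hM₁S h)) (fun Q h => hl Q (hM₁S h))
      (hV.subset hM₁S) (hU.subset hM₁S) (fun Q hQ => ?_) ?_
    · refine le_trans ?_ (hA Q (hM₁S hQ))
      have := hσ Q (hM₁S hQ)
      refine mul_le_mul_of_nonneg_right ?_ (by positivity)
      refine Finset.sum_le_sum_of_subset_of_nonneg (Finset.filter_subset_filter _ hM₁S) ?_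
      intro P hP _
      have hP := (Finset.mem_filter.1 hP).1
      have := hl P hP; have := hu P hP
      positivity
    · intro Q hQ Q' hQ' hle ea eb em
      obtain ⟨-, hQ2⟩ := Finset.mem_filter.1 hQ
      have ek := hQ2 Q' (hM₁S hQ') hle ea.symm eb.symm em.symm
      exact (Finset.mem_filter.1 (Finset.mem_filter.1 hQ').1).2 Q (hM₁S hQ) hle ea eb ek.symm em
  have b2 : ∑ Q ∈ M₂, l Q * σ Q * u Q * F Q * G Q ≤ C₂ := by
    have := h2 M₂ u G σ F l U V (fun Q h => hu Q (hM₂S h)) (fun Q h => hG Q (hM₂S h))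
      (fun Q h => hσ Q (hM₂S h)) (fun Q h => hF Q (hM₂S h)) (fun Q h => hl Q (hM₂S h))
      (hU.subset hM₂S) (hV.subset hM₂S) (fun Q hQ => ?_) ?_
    · refine le_trans (le_of_eq (Finset.sum_congr rfl fun Q _ => by ring)) this
    · refine le_trans ?_ (hB Q (hM₂S hQ))
      have := hu Q (hM₂S hQ)
      refine mul_le_mul_of_nonneg_right ?_ (by positivity)
      refine Finset.sum_le_sum_of_subset_of_nonneg (Finset.filter_subset_filter _ hM₂S) ?_
      intro P hP _
      have hP := (Finset.mem_filter.1 hP).1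
      have := hl P hP; have := hσ P hP
      positivity
    · intro Q hQ Q' hQ' hle eb ea ek
      obtain ⟨-, hQ2⟩ := Finset.mem_filter.1 hQ
      have em := hQ2 Q' (hM₂S hQ') hle eb.symm ea.symm ek.symm
      exact (Finset.mem_filter.1 (Finset.mem_filter.1 hQ').1).2 Q (hM₂S hQ) hle ea eb ek em.symm
  calc _ ≤ _ := step
    _ ≤ ∑ Q ∈ M, c * K * (l Q * σ Q * u Q * F Q * G Q) := by
        refine Finset.sum_le_sum fun Q hQ => ?_
        rw [← Finset.sum_mul]
        have := hσ Q (hMS hQ); have := hF Q (hMS hQ); have := hu Q (hMS hQ)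
        have := hG Q (hMS hQ)
        calc _ ≤ (K * l Q) * (c * (σ Q * u Q * F Q * G Q)) := by
              gcongr; exact hlsum Q (hMS hQ)
          _ = _ := by ring
    _ = c * K * ∑ Q ∈ M, l Q * σ Q * u Q * F Q * G Q := by rw [Finset.mul_sum]
    _ ≤ c * K * (C₁ + C₂) := by
        gcongr
        calc _ ≤ ∑ Q ∈ M₁ ∪ M₂, l Q * σ Q * u Q * F Q * G Q :=
              Finset.sum_le_sum_of_subset_of_nonneg hcover fun Q hQ _ =>
                hpos Q (Finset.union_subset hM₁S hM₂S hQ)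
          _ ≤ ∑ Q ∈ M₁, l Q * σ Q * u Q * F Q * G Q +
              ∑ Q ∈ M₂, l Q * σ Q * u Q * F Q * G Q := by
              rw [← Finset.sum_union_inter]
              refine le_add_of_nonneg_right (Finset.sum_nonneg fun Q hQ => hpos Q ?_)
              exact hM₁S (Finset.mem_inter.1 hQ).1
          _ ≤ _ := add_le_add b1 b2

/-- A finite family of sets, any two of which are nested or disjoint. -/
def Laminar {X : Type*} (S : Finset (Set X)) : Prop :=
  ∀ Q ∈ S, ∀ R ∈ S, Q ⊆ R ∨ R ⊆ Q ∨ Disjoint Q R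

lemma Laminar.subset {X : Type*} {S T : Finset (Set X)} (h : Laminar S) (hT : T ⊆ S) :
    Laminar T :=
  fun Q hQ R hR => h Q (hT hQ) R (hT hR)

lemma Laminar.pairwiseDisjoint {X : Type*} {S : Finset (Set X)} (h : Laminar S)
    (hS : IsAntichain (· ≤ ·) (S : Set (Set X))) : (S : Set (Set X)).PairwiseDisjoint id := by
  intro Q hQ R hR hne
  rcases h Q hQ R hR with h | h | h
  · exact absurd h (hS hQ hR hne)
  · exact absurd h (hS hR hQ hne.symm)
  · exact h

lemma Laminar.mul_measure_biUnion_le {X : Type*} [MeasurableSpace X] {μ : Measure X}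
    {S : Finset (Set X)} (h : Laminar S) (hS : ∀ Q ∈ S, MeasurableSet Q) {c : ℝ≥0∞}
    {g : X → ℝ≥0∞} (hc : ∀ Q ∈ S, c * μ Q ≤ ∫⁻ x in Q, g x ∂μ) :
    c * μ (⋃ Q ∈ S, Q) ≤ ∫⁻ x, g x ∂μ := by
  classical
  set M := S.filter fun Q => Maximal (· ∈ S) Q with hM
  have hMS : M ⊆ S := Finset.filter_subset _ _
  have hanti : IsAntichain (· ≤ ·) (M : Set (Set X)) := by
    intro Q hQ R hR hne hle
    exact hne (hle.antisymm ((Finset.mem_filter.1 hQ).2.2 (hMS hR) hle))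
  have hU : (⋃ Q ∈ S, Q) ⊆ ⋃ Q ∈ M, Q := by
    refine iUnion₂_subset fun Q hQ => ?_
    obtain ⟨R, hle, hR⟩ := S.exists_le_maximal hQ
    exact hle.trans (subset_biUnion_of_mem (u := fun Q => Q) (Finset.mem_filter.2 ⟨hR.1, hR⟩))
  calc c * μ (⋃ Q ∈ S, Q) ≤ c * ∑ Q ∈ M, μ Q := by
        gcongr
        exact (measure_mono hU).trans (measure_biUnion_finset_le _ _)
    _ ≤ ∑ Q ∈ M, ∫⁻ x in Q, g x ∂μ := by
        rw [Finset.mul_sum]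
        exact Finset.sum_le_sum fun Q hQ => hc Q (hMS hQ)
    _ = ∫⁻ x in ⋃ Q ∈ M, Q, g x ∂μ :=
        (lintegral_biUnion_finset ((h.subset hMS).pairwiseDisjoint hanti)
          (fun Q hQ => hS Q (hMS hQ)) _).symm
    _ ≤ _ := setLIntegral_le_lintegral _ _

/-- The average of `f` over `Q`. -/
def avgOn {X : Type*} [MeasurableSpace X] (μ : Measure X) (f : X → ℝ≥0∞) (Q : Set X) : NNReal :=
  ((∫⁻ x in Q, f x ∂μ) / μ Q).toNNReal

open scoped Classical in
/-- The largest average of `f` over members of `S` containing `Q`. -/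
def maxAvg {X : Type*} [MeasurableSpace X] (μ : Measure X) (f : X → ℝ≥0∞) (S : Finset (Set X))
    (Q : Set X) : NNReal :=
  (S.filter (Q ⊆ ·)).sup (avgOn μ f)

lemma exists_pointwise_geometric_le {p : ℝ} (hp : 1 < p) : ∃ C : ℝ, 0 < C ∧
    ∀ (E : Finset ℤ) (y : ℝ≥0∞),
      ∑ k ∈ E, ENNReal.ofReal (2 ^ ((k : ℝ) * (p - 1))) *
        (if ENNReal.ofReal (2 ^ (k : ℝ)) < 2 * y then y else 0) ≤ ENNReal.ofReal C * y ^ p := by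
  obtain ⟨C, hC, h⟩ := exists_geometric_sum_le (ε := p - 1) (by linarith)
  refine ⟨C * 2 ^ (p - 1), by positivity, fun E y => ?_⟩
  rcases eq_or_ne y ∞ with rfl | hy
  · rw [ENNReal.top_rpow_of_pos (by linarith), ENNReal.mul_top
      (ENNReal.ofReal_pos.2 (by positivity)).ne']
    exact le_top
  lift y to NNReal using hy
  have e1 : (2 * (y : ℝ≥0∞)) = ENNReal.ofReal (2 * y) := by
    rw [ENNReal.ofReal_mul (by norm_num), ENNReal.ofReal_coe_nnreal]; norm_num
  rw [e1]
  have := h (E.filter fun k : ℤ => (2 : ℝ) ^ (k : ℝ) < 2 * y) (2 * y) (by positivity)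
    (fun k hk => (Finset.mem_filter.1 hk).2.le)
  calc _ = ENNReal.ofReal (∑ k ∈ E with (2 : ℝ) ^ ((k : ℤ) : ℝ) < 2 * y,
          2 ^ ((k : ℝ) * (p - 1))) * y := by
        rw [ENNReal.ofReal_sum_of_nonneg (fun _ _ => by positivity), Finset.sum_mul,
          Finset.sum_filter]
        refine Finset.sum_congr rfl fun k _ => ?_
        by_cases hk : (2 : ℝ) ^ (k : ℝ) < 2 * y
        · rw [if_pos hk, if_pos]
          exact (ENNReal.ofReal_lt_ofReal_iff_of_nonneg (by positivity)).2 hk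
        · rw [if_neg hk, if_neg, mul_zero]
          rwa [ENNReal.ofReal_lt_ofReal_iff_of_nonneg (by positivity)]
    _ ≤ ENNReal.ofReal (C * (2 * y) ^ (p - 1)) * y := by gcongr
    _ = ENNReal.ofReal (C * 2 ^ (p - 1)) * ENNReal.ofReal ((y : ℝ) ^ p) := by
        rw [← ENNReal.ofReal_coe_nnreal (p := y), ← ENNReal.ofReal_mul (by positivity),
          ← ENNReal.ofReal_mul (by positivity), Real.mul_rpow (by norm_num) (by positivity)]
        congr 1
        rcases eq_or_ne (y : ℝ) 0 with h0 | h0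
        · rw [h0, Real.zero_rpow (by linarith : p ≠ 0)]; ring
        · rw [Real.rpow_sub_one h0]; field_simp
    _ = _ := by
        rw [← ENNReal.ofReal_coe_nnreal (p := y), ENNReal.ofReal_rpow_of_nonneg (by positivity)
          (by linarith)]

open scoped Classical in
/-- The Carleson-type level set bounds for averages over a laminar family. -/
lemma exists_levelBound {p : ℝ} (hp : 1 < p) : ∃ K : ℝ, 0 < K ∧
    ∀ {X : Type} [MeasurableSpace X] (μ : Measure X) (S : Finset (Set X)) (f : X → ℝ≥0∞),
      Measurable f → Laminar S → (∀ Q ∈ S, MeasurableSet Q) → (∀ Q ∈ S, μ Q ≠ 0) →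
      (∀ Q ∈ S, μ Q ≠ ∞) → ∫⁻ x, f x ^ p ∂μ ≤ 1 →
      ∃ V : ℤ → ℝ, LevelBound S (fun Q => (μ Q).toReal) (fun Q => maxAvg μ f S Q) p K V := by
  obtain ⟨C, hC, h⟩ := exists_pointwise_geometric_le hp
  refine ⟨2 * C, by positivity, ?_⟩
  intro X _ μ S f hf hS hmeas h0 htop hfp
  set T : ℤ → Finset (Set X) := fun k => S.filter fun R => (2 : ℝ) ^ (k : ℝ) ≤ avgOn μ f R with hT
  have hTS : ∀ k, T k ⊆ S := fun k => Finset.filter_subset _ _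
  have hUfin : ∀ k, μ (⋃ R ∈ T k, R) ≠ ∞ := fun k =>
    ((measure_biUnion_finset_le _ _).trans_lt
      (ENNReal.sum_lt_top.2 fun R hR => (htop R (hTS k hR)).lt_top)).ne
  refine ⟨fun k => (μ (⋃ R ∈ T k, R)).toReal, ?_, ?_⟩
  · intro k T' hT' hanti hk
    have hd := (hS.subset hT').pairwiseDisjoint hanti
    have hb := measure_biUnion_finset (μ := μ) hd (fun Q hQ => hmeas Q (hT' hQ))
    simp only [id] at hb
    rw [← ENNReal.toReal_sum (fun Q hQ => htop Q (hT' hQ)), ← hb]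
    refine ENNReal.toReal_mono (hUfin k) (measure_mono (iUnion₂_subset fun Q hQ => ?_))
    have h1 : ((2 : ℝ) ^ (k : ℝ)).toNNReal ≤ maxAvg μ f S Q :=
      Real.toNNReal_le_iff_le_coe.2 (hk Q hQ)
    have h2 : (⊥ : NNReal) < ((2 : ℝ) ^ (k : ℝ)).toNNReal := Real.toNNReal_pos.2 (by positivity)
    rw [maxAvg, Finset.le_sup_iff h2] at h1
    obtain ⟨R, hR, hle⟩ := h1
    rw [Real.toNNReal_le_iff_le_coe] at hle
    have hR := Finset.mem_filter.1 hR
    exact hR.2.trans (subset_biUnion_of_mem (u := fun Q => Q)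
      (Finset.mem_coe.2 (Finset.mem_filter.2 ⟨hR.1, hle⟩)))
  · intro E
    have hk : ∀ k : ℤ, ENNReal.ofReal (2 ^ (k : ℝ)) * μ (⋃ R ∈ T k, R) ≤
        2 * ∫⁻ x, (if ENNReal.ofReal (2 ^ (k : ℝ)) < 2 * f x then f x else 0) ∂μ := by
      intro k
      set c := ENNReal.ofReal (2 ^ (k : ℝ)) with hc
      have hct : c ≠ ∞ := ENNReal.ofReal_ne_top
      have := (hS.subset (hTS k)).mul_measure_biUnion_le (μ := μ) (c := c / 2)
        (g := fun x => if c < 2 * f x then f x else 0) (fun Q hQ => hmeas Q (hTS k hQ))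
        (fun Q hQ => ?_)
      · calc c * μ (⋃ R ∈ T k, R) = 2 * (c / 2 * μ (⋃ R ∈ T k, R)) := by
              rw [← mul_assoc, ENNReal.mul_div_cancel (by norm_num) (by norm_num)]
          _ ≤ _ := by gcongr
      · have hQ' := Finset.mem_filter.1 hQ
        have hm0 := h0 Q hQ'.1
        have hmt := htop Q hQ'.1
        have h1 : c * μ Q ≤ ∫⁻ x in Q, f x ∂μ := by
          rw [← ENNReal.le_div_iff_mul_le (Or.inl hm0) (Or.inl hmt)]
          refine le_trans ?_ (ENNReal.coe_toNNReal_le_self (a := (∫⁻ x in Q, f x ∂μ) / μ Q))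
          rw [hc]
          exact (ENNReal.ofReal_le_ofReal hQ'.2).trans_eq ENNReal.ofReal_coe_nnreal
        have h2 : ∫⁻ x in Q, f x ∂μ ≤
            c / 2 * μ Q + ∫⁻ x in Q, (if c < 2 * f x then f x else 0) ∂μ := by
          rw [← setLIntegral_const, ← lintegral_add_left measurable_const]
          refine lintegral_mono fun x => ?_
          split_ifs with hx
          · exact le_add_self
          · rw [add_zero, ENNReal.le_div_iff_mul_le (by simp) (by simp), mul_comm]
            exact not_lt.1 hx
        have h3 : c / 2 * μ Q + c / 2 * μ Q = c * μ Q := by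
          rw [← add_mul, ENNReal.add_halves]
        have h4 : c / 2 * μ Q ≠ ∞ :=
          ENNReal.mul_ne_top (ENNReal.div_ne_top hct (by norm_num)) hmt
        rw [← h3] at h1
        exact (ENNReal.add_le_add_iff_left h4).1 (h1.trans h2)
    have hmain : ∑ k ∈ E, ENNReal.ofReal (2 ^ ((k : ℝ) * p)) * μ (⋃ R ∈ T k, R) ≤
        ENNReal.ofReal (2 * C) := by
      calc _ ≤ ∑ k ∈ E, 2 * ∫⁻ x, ENNReal.ofReal (2 ^ ((k : ℝ) * (p - 1))) *
            (if ENNReal.ofReal (2 ^ (k : ℝ)) < 2 * f x then f x else 0) ∂μ := by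
            refine Finset.sum_le_sum fun k _ => ?_
            have e : (2 : ℝ) ^ ((k : ℝ) * p) = 2 ^ ((k : ℝ) * (p - 1)) * 2 ^ (k : ℝ) := by
              rw [← Real.rpow_add (by norm_num)]; congr 1; ring
            rw [e, ENNReal.ofReal_mul (by positivity), mul_assoc,
              lintegral_const_mul' _ _ ENNReal.ofReal_ne_top, mul_left_comm 2]
            exact mul_le_mul_right (hk k) _
        _ = 2 * ∫⁻ x, ∑ k ∈ E, ENNReal.ofReal (2 ^ ((k : ℝ) * (p - 1))) *
            (if ENNReal.ofReal (2 ^ (k : ℝ)) < 2 * f x then f x else 0) ∂μ := by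
            rw [← Finset.mul_sum, lintegral_finsetSum]
            intro k _
            refine Measurable.const_mul ?_ _
            exact Measurable.ite (measurableSet_lt measurable_const (hf.const_mul _)) hf
              measurable_const
        _ ≤ 2 * ∫⁻ x, ENNReal.ofReal C * f x ^ p ∂μ := by
            gcongr with x
            exact h E (f x)
        _ = 2 * (ENNReal.ofReal C * ∫⁻ x, f x ^ p ∂μ) := by
            rw [lintegral_const_mul' _ _ ENNReal.ofReal_ne_top]
        _ ≤ 2 * (ENNReal.ofReal C * 1) := by gcongr
        _ = _ := by rw [ENNReal.ofReal_mul (by norm_num)]; norm_num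
    have e2 : ∑ k ∈ E, (2 : ℝ) ^ ((k : ℝ) * p) * (μ (⋃ R ∈ T k, R)).toReal =
        (∑ k ∈ E, ENNReal.ofReal (2 ^ ((k : ℝ) * p)) * μ (⋃ R ∈ T k, R)).toReal := by
      rw [ENNReal.toReal_sum fun k _ => ENNReal.mul_ne_top ENNReal.ofReal_ne_top (hUfin k)]
      refine Finset.sum_congr rfl fun k _ => ?_
      rw [ENNReal.toReal_mul, ENNReal.toReal_ofReal (by positivity)]
    rw [e2]
    exact ENNReal.toReal_le_of_le_ofReal (by positivity) hmain

lemma LevelBound.mono {ι : Type*} [PartialOrder ι] {T : Finset ι} {σ F : ι → ℝ} {p K K' : ℝ}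
    {V : ℤ → ℝ} (h : LevelBound T σ F p K V) (hK : K ≤ K') : LevelBound T σ F p K' V :=
  ⟨h.1, fun E => (h.2 E).trans hK⟩

lemma setLIntegral_le_rpow_mul {X : Type*} [MeasurableSpace X] {μ : Measure X} {p p' : ℝ}
    (hpp : p.HolderConjugate p') {f : X → ℝ≥0∞} (hf : Measurable f) (Q : Set X) :
    ∫⁻ x in Q, f x ∂μ ≤ (∫⁻ x, f x ^ p ∂μ) ^ (1 / p) * μ Q ^ (1 / p') := by
  have := ENNReal.lintegral_mul_le_Lp_mul_Lq (μ.restrict Q) hpp hf.aemeasurable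
    (measurable_const (a := (1 : ℝ≥0∞))).aemeasurable
  simp only [Pi.mul_apply, mul_one, ENNReal.one_rpow, lintegral_one,
    Measure.restrict_apply_univ] at this
  refine this.trans ?_
  gcongr
  · exact one_div_nonneg.2 hpp.nonneg
  · exact Measure.restrict_le_self

lemma setLIntegral_eq_zero_of_rpow {X : Type*} [MeasurableSpace X] {μ : Measure X} {p : ℝ}
    (hp : 0 < p) {f : X → ℝ≥0∞} (hf : Measurable f) (h : ∫⁻ x, f x ^ p ∂μ = 0) (Q : Set X) :
    ∫⁻ x in Q, f x ∂μ = 0 := by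
  have h1 := (lintegral_eq_zero_iff (hf.pow_const p)).1 h
  refine lintegral_eq_zero_of_ae_eq_zero (ae_restrict_of_ae ?_)
  filter_upwards [h1] with x hx
  simpa [hp, hp.not_gt] using hx

lemma avgOn_le_maxAvg {X : Type*} [MeasurableSpace X] {μ : Measure X} {f : X → ℝ≥0∞}
    {S : Finset (Set X)} {Q : Set X} (hQ : Q ∈ S) : avgOn μ f Q ≤ maxAvg μ f S Q := by
  classical
  exact Finset.le_sup (f := avgOn μ f) (Finset.mem_filter.2 ⟨hQ, Subset.rfl⟩)

lemma maxAvg_anti {X : Type*} [MeasurableSpace X] {μ : Measure X} {f : X → ℝ≥0∞}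
    {S : Finset (Set X)} {Q R : Set X} (h : Q ⊆ R) : maxAvg μ f S R ≤ maxAvg μ f S Q := by
  classical
  exact Finset.sup_mono fun P hP => Finset.mem_filter.2
    ⟨(Finset.mem_filter.1 hP).1, h.trans (Finset.mem_filter.1 hP).2⟩

lemma coe_avgOn_mul {X : Type*} [MeasurableSpace X] {μ : Measure X} {f : X → ℝ≥0∞} {Q : Set X}
    (h0 : μ Q ≠ 0) (ht : μ Q ≠ ∞) (hf : ∫⁻ x in Q, f x ∂μ ≠ ∞) :
    ENNReal.ofReal ((μ Q).toReal * avgOn μ f Q) = ∫⁻ x in Q, f x ∂μ := by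
  rw [ENNReal.ofReal_mul ENNReal.toReal_nonneg, ENNReal.ofReal_toReal ht, ENNReal.ofReal_coe_nnreal,
    avgOn, ENNReal.coe_toNNReal (ENNReal.div_ne_top hf h0), ENNReal.mul_div_cancel h0 ht]

lemma avgOn_pos {X : Type*} [MeasurableSpace X] {μ : Measure X} {f : X → ℝ≥0∞} {Q : Set X}
    (h0 : μ Q ≠ 0) (ht : μ Q ≠ ∞) (hf : ∫⁻ x in Q, f x ∂μ ≠ ∞) (hf0 : ∫⁻ x in Q, f x ∂μ ≠ 0) :
    0 < avgOn μ f Q :=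
  ENNReal.toNNReal_pos (ENNReal.div_pos hf0 ht).ne' (ENNReal.div_ne_top hf h0)

open scoped Classical in
lemma tail_toReal_le_one {X : Type*} [MeasurableSpace X] {μ ν : Measure X} {S : Finset (Set X)}
    {l : Set X → ℝ} {q e : ℝ} (hq : 0 ≤ q) (hl : ∀ Q ∈ S, 0 < l Q)
    (hν : ∀ Q ∈ S, ν Q ≠ ∞) {Q : Set X}
    (h : (∑ R ∈ S with Q ⊆ R, ENNReal.ofReal (l R) ^ q * ν R) * μ Q ^ e ≤ 1) :
    (∑ R ∈ S with Q ⊆ R, l R ^ q * (ν R).toReal) * (μ Q).toReal ^ e ≤ 1 := by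
  have := ENNReal.toReal_mono ENNReal.one_ne_top h
  rw [ENNReal.toReal_mul, ENNReal.toReal_one, ENNReal.toReal_sum fun R hR =>
    ENNReal.mul_ne_top (ENNReal.rpow_ne_top_of_nonneg hq ENNReal.ofReal_ne_top)
      (hν R (Finset.mem_filter.1 hR).1), ← ENNReal.toReal_rpow] at this
  refine le_trans (le_of_eq ?_) this
  congr 1
  refine Finset.sum_congr rfl fun R hR => ?_
  rw [ENNReal.toReal_mul, ← ENNReal.toReal_rpow,
    ENNReal.toReal_ofReal (hl R (Finset.mem_filter.1 hR).1).le]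

open scoped Classical in
lemma exists_laminar_normalized_le {p q p' r K : ℝ} (hp : 1 < p) (hpq : p < q)
    (hpp : p.HolderConjugate p') (hqr : q.HolderConjugate r) :
    ∃ C : ℝ, 0 < C ∧ ∀ {X : Type} [MeasurableSpace X] (μ ν : Measure X) (S : Finset (Set X))
      (l : Set X → ℝ) (f g : X → ℝ≥0∞), Measurable f → Measurable g → Laminar S →
      (∀ Q ∈ S, MeasurableSet Q) → (∀ Q ∈ S, μ Q ≠ 0) → (∀ Q ∈ S, μ Q ≠ ∞) →
      (∀ Q ∈ S, ν Q ≠ 0) → (∀ Q ∈ S, ν Q ≠ ∞) → (∀ Q ∈ S, ∫⁻ x in Q, f x ∂μ ≠ 0) →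
      (∀ Q ∈ S, ∫⁻ x in Q, g x ∂ν ≠ 0) → (∀ Q ∈ S, 0 < l Q) →
      (∀ Q ∈ S, ∑ R ∈ S with Q ⊆ R, l R ≤ K * l Q) →
      (∀ Q ∈ S, (∑ R ∈ S with Q ⊆ R, ENNReal.ofReal (l R) ^ q * ν R) *
        μ Q ^ (q * (1 - 1 / p)) ≤ 1) →
      (∀ Q ∈ S, (∑ R ∈ S with Q ⊆ R, ENNReal.ofReal (l R) ^ p' * μ R) *
        ν Q ^ (p' * (1 - 1 / r)) ≤ 1) →
      ∫⁻ x, f x ^ p ∂μ ≤ 1 → ∫⁻ x, g x ^ r ∂ν ≤ 1 →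
      ∑ Q ∈ S, ENNReal.ofReal (l Q) * (∫⁻ x in Q, f x ∂μ) * (∫⁻ x in Q, g x ∂ν) ≤
        ENNReal.ofReal C := by
  obtain ⟨K₁, hK₁, h1⟩ := exists_levelBound hp
  obtain ⟨K₂, hK₂, h2⟩ := exists_levelBound hqr.symm.lt
  obtain ⟨C, hC, h⟩ := exists_bilinear_le (K := K₁ + K₂ + |K|) hp hpq hpp hqr (by positivity)
  refine ⟨C, hC, ?_⟩
  intro X _ μ ν S l f g hf hg hS hmeas hμ0 hμt hν0 hνt hf0 hg0 hl hlsum hA hB hfp hgr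
  obtain ⟨V, hV⟩ := h1 μ S f hf hS hmeas hμ0 hμt hfp
  obtain ⟨U, hU⟩ := h2 ν S g hg hS hmeas hν0 hνt hgr
  have hft : ∀ Q ∈ S, ∫⁻ x in Q, f x ∂μ ≠ ∞ := fun Q hQ =>
    ((setLIntegral_le_rpow_mul hpp hf Q).trans_lt (ENNReal.mul_lt_top
      (ENNReal.rpow_lt_top_of_nonneg hpp.one_div_nonneg (hfp.trans_lt one_lt_top).ne)
      (ENNReal.rpow_lt_top_of_nonneg hpp.symm.one_div_nonneg (hμt Q hQ)))).ne
  have hgt : ∀ Q ∈ S, ∫⁻ x in Q, g x ∂ν ≠ ∞ := fun Q hQ =>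
    ((setLIntegral_le_rpow_mul hqr.symm hg Q).trans_lt (ENNReal.mul_lt_top
      (ENNReal.rpow_lt_top_of_nonneg hqr.symm.one_div_nonneg (hgr.trans_lt one_lt_top).ne)
      (ENNReal.rpow_lt_top_of_nonneg hqr.one_div_nonneg (hνt Q hQ)))).ne
  have key := h S (fun Q => (μ Q).toReal) (fun Q => (maxAvg μ f S Q : ℝ))
    (fun Q => (ν Q).toReal) (fun Q => (maxAvg ν g S Q : ℝ)) l V U
    (fun Q hQ => ENNReal.toReal_pos (hμ0 Q hQ) (hμt Q hQ))
    (fun Q hQ => (avgOn_pos (hμ0 Q hQ) (hμt Q hQ) (hft Q hQ) (hf0 Q hQ)).trans_le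
      (avgOn_le_maxAvg hQ))
    (fun Q hQ => ENNReal.toReal_pos (hν0 Q hQ) (hνt Q hQ))
    (fun Q hQ => (avgOn_pos (hν0 Q hQ) (hνt Q hQ) (hgt Q hQ) (hg0 Q hQ)).trans_le
      (avgOn_le_maxAvg hQ))
    hl ?_ (fun Q _ R _ hle => maxAvg_anti hle) (fun Q _ R _ hle => maxAvg_anti hle) ?_
    (hV.mono ?_) (hU.mono ?_)
    (fun Q hQ => tail_toReal_le_one hqr.nonneg hl hνt (hA Q hQ))
    (fun Q hQ => tail_toReal_le_one hpp.symm.nonneg hl hμt (hB Q hQ))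
  · rw [← ENNReal.ofReal_le_ofReal_iff hC.le] at key
    refine le_trans ?_ key
    rw [ENNReal.ofReal_sum_of_nonneg fun Q hQ => by have := hl Q hQ; positivity]
    refine Finset.sum_le_sum fun Q hQ => ?_
    have hlQ := hl Q hQ
    rw [← coe_avgOn_mul (hμ0 Q hQ) (hμt Q hQ) (hft Q hQ),
      ← coe_avgOn_mul (hν0 Q hQ) (hνt Q hQ) (hgt Q hQ), ← ENNReal.ofReal_mul (by positivity),
      ← ENNReal.ofReal_mul (by positivity)]
    refine ENNReal.ofReal_le_ofReal ?_
    have a1 : (avgOn μ f Q : ℝ) ≤ maxAvg μ f S Q := avgOn_le_maxAvg hQ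
    have a2 : (avgOn ν g Q : ℝ) ≤ maxAvg ν g S Q := avgOn_le_maxAvg hQ
    calc _ = l Q * (μ Q).toReal * (ν Q).toReal * avgOn μ f Q * avgOn ν g Q := by ring
      _ ≤ _ := by gcongr
  · intro Q hQ R hR P hP hQR hQP
    rcases hS R hR P hP with h | h | h
    · exact Or.inl h
    · exact Or.inr h
    · have : Q = ∅ := Set.subset_empty_iff.1 (h hQR hQP)
      exact absurd (by rw [this, measure_empty]) (hμ0 Q hQ)
  · intro Q hQ
    refine (hlsum Q hQ).trans (mul_le_mul_of_nonneg_right ?_ (hl Q hQ).le)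
    have := le_abs_self K
    linarith
  · have := abs_nonneg K; linarith
  · have := abs_nonneg K; linarith

open scoped Classical in
/-- Two-weight bilinear estimate over a laminar family, from tail testing conditions. -/
lemma exists_laminar_bilinear_le {p q p' r K : ℝ} (hp : 1 < p) (hpq : p < q)
    (hpp : p.HolderConjugate p') (hqr : q.HolderConjugate r) :
    ∃ C : ℝ, 0 < C ∧ ∀ {X : Type} [MeasurableSpace X] (μ ν : Measure X) (S : Finset (Set X))
      (l : Set X → ℝ) (D : ℝ) (f g : X → ℝ≥0∞), 0 < D → Measurable f → Measurable g →
      Laminar S → (∀ Q ∈ S, MeasurableSet Q) → (∀ Q ∈ S, μ Q ≠ ∞) → (∀ Q ∈ S, ν Q ≠ ∞) →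
      (∀ Q ∈ S, 0 < l Q) → (∀ Q ∈ S, ∑ R ∈ S with Q ⊆ R, l R ≤ K * l Q) →
      (∀ Q ∈ S, μ Q ≠ 0 → (∑ R ∈ S with Q ⊆ R, ENNReal.ofReal (l R) ^ q * ν R) *
        μ Q ^ (q * (1 - 1 / p)) ≤ ENNReal.ofReal D ^ q) →
      (∀ Q ∈ S, ν Q ≠ 0 → (∑ R ∈ S with Q ⊆ R, ENNReal.ofReal (l R) ^ p' * μ R) *
        ν Q ^ (p' * (1 - 1 / r)) ≤ ENNReal.ofReal D ^ p') →
      ∑ Q ∈ S, ENNReal.ofReal (l Q) * (∫⁻ x in Q, f x ∂μ) * (∫⁻ x in Q, g x ∂ν) ≤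
        ENNReal.ofReal (C * D) *
          ((∫⁻ x, f x ^ p ∂μ) ^ (1 / p) * (∫⁻ x, g x ^ r ∂ν) ^ (1 / r)) := by
  obtain ⟨C, hC, h⟩ := exists_laminar_normalized_le (K := K) hp hpq hpp hqr
  refine ⟨C, hC, ?_⟩
  intro X _ μ ν S l D f g hD hf hg hS hmeas hμt hνt hl hlsum hA hB
  rcases eq_or_ne (∫⁻ x, f x ^ p ∂μ) 0 with hF0 | hF0
  · simp [setLIntegral_eq_zero_of_rpow hpp.pos hf hF0]
  rcases eq_or_ne (∫⁻ x, g x ^ r ∂ν) 0 with hG0 | hG0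
  · simp [setLIntegral_eq_zero_of_rpow hqr.symm.pos hg hG0]
  set N := (∫⁻ x, f x ^ p ∂μ) ^ (1 / p) with hN
  set M := (∫⁻ x, g x ^ r ∂ν) ^ (1 / r) with hM
  have hN0 : N ≠ 0 := by
    rw [hN, Ne, ENNReal.rpow_eq_zero_iff_of_pos hpp.one_div_pos]; exact hF0
  have hM0 : M ≠ 0 := by
    rw [hM, Ne, ENNReal.rpow_eq_zero_iff_of_pos hqr.symm.one_div_pos]; exact hG0
  have hCD : ENNReal.ofReal (C * D) ≠ 0 := (ENNReal.ofReal_pos.2 (by positivity)).ne'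
  rcases eq_or_ne N ∞ with hNt | hNt
  · rw [hNt, ENNReal.top_mul hM0, ENNReal.mul_top hCD]; exact le_top
  rcases eq_or_ne M ∞ with hMt | hMt
  · rw [hMt, ENNReal.mul_top hN0, ENNReal.mul_top hCD]; exact le_top
  set S' := S.filter fun Q => (μ Q ≠ 0 ∧ ν Q ≠ 0) ∧ ∫⁻ x in Q, f x ∂μ ≠ 0 ∧
    ∫⁻ x in Q, g x ∂ν ≠ 0 with hS'
  have hSS : S' ⊆ S := Finset.filter_subset _ _
  have hmem : ∀ Q ∈ S', (μ Q ≠ 0 ∧ ν Q ≠ 0) ∧ ∫⁻ x in Q, f x ∂μ ≠ 0 ∧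
    ∫⁻ x in Q, g x ∂ν ≠ 0 := fun Q hQ => (Finset.mem_filter.1 hQ).2
  have hsum : ∑ Q ∈ S, ENNReal.ofReal (l Q) * (∫⁻ x in Q, f x ∂μ) * (∫⁻ x in Q, g x ∂ν) =
      ∑ Q ∈ S', ENNReal.ofReal (l Q) * (∫⁻ x in Q, f x ∂μ) * (∫⁻ x in Q, g x ∂ν) := by
    refine (Finset.sum_subset hSS fun Q hQ hQ' => ?_).symm
    have h3 : ∫⁻ x in Q, f x ∂μ = 0 ∨ ∫⁻ x in Q, g x ∂ν = 0 := by
      by_contra hcon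
      push Not at hcon
      refine hQ' (Finset.mem_filter.2 ⟨hQ, ⟨fun h0 => hcon.1 ?_, fun h0 => hcon.2 ?_⟩, hcon⟩)
      · exact setLIntegral_measure_zero _ _ h0
      · exact setLIntegral_measure_zero _ _ h0
    rcases h3 with h3 | h3 <;> simp [h3]
  have hD0 : ENNReal.ofReal D ≠ 0 := (ENNReal.ofReal_pos.2 hD).ne'
  have htail : ∀ {m₁ m₂ : Measure X} {s t : ℝ} (_ : 0 < s) (Q : Set X),
      (∑ R ∈ S with Q ⊆ R, ENNReal.ofReal (l R) ^ s * m₁ R) * m₂ Q ^ t ≤ ENNReal.ofReal D ^ s →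
      (∑ R ∈ S' with Q ⊆ R, ENNReal.ofReal (l R / D) ^ s * m₁ R) * m₂ Q ^ t ≤ 1 := by
    intro m₁ m₂ s t hs Q hQ
    have hDs0 : ENNReal.ofReal D ^ s ≠ 0 := by
      rw [Ne, ENNReal.rpow_eq_zero_iff_of_pos hs]; exact hD0
    have hDst : ENNReal.ofReal D ^ s ≠ ∞ :=
      ENNReal.rpow_ne_top_of_nonneg hs.le ENNReal.ofReal_ne_top
    have e : ∀ R, ENNReal.ofReal (l R / D) ^ s * m₁ R =
        (ENNReal.ofReal (l R) ^ s * m₁ R) * (ENNReal.ofReal D ^ s)⁻¹ := by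
      intro R
      rw [ENNReal.ofReal_div_of_pos hD, ENNReal.div_rpow_of_nonneg _ _ hs.le, div_eq_mul_inv,
        mul_right_comm]
    simp_rw [e]
    rw [← Finset.sum_mul, mul_right_comm, ← div_eq_mul_inv]
    refine ENNReal.div_le_of_le_mul (le_trans ?_ (hQ.trans_eq (one_mul _).symm))
    gcongr
  have hnorm : ∀ {m : Measure X} {s : ℝ} {w : X → ℝ≥0∞} (_ : 0 < s) (_ : Measurable w),
      (∫⁻ x, w x ^ s ∂m) ^ (1 / s) ≠ 0 → (∫⁻ x, w x ^ s ∂m) ^ (1 / s) ≠ ∞ →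
      ∫⁻ x, (w x * ((∫⁻ x, w x ^ s ∂m) ^ (1 / s))⁻¹) ^ s ∂m ≤ 1 := by
    intro m s w hs hw h0 ht
    simp_rw [ENNReal.mul_rpow_of_nonneg _ _ hs.le]
    rw [lintegral_mul_const _ (hw.pow_const s), ENNReal.inv_rpow, ← ENNReal.rpow_mul,
      one_div_mul_cancel hs.ne', ENNReal.rpow_one]
    exact ENNReal.mul_inv_le_one _
  have key := h μ ν S' (fun Q => l Q / D) (fun x => f x * N⁻¹) (fun x => g x * M⁻¹)
    (hf.mul_const _) (hg.mul_const _) (hS.subset hSS) (fun Q hQ => hmeas Q (hSS hQ))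
    (fun Q hQ => (hmem Q hQ).1.1) (fun Q hQ => hμt Q (hSS hQ))
    (fun Q hQ => (hmem Q hQ).1.2) (fun Q hQ => hνt Q (hSS hQ))
    (fun Q hQ => by
      rw [lintegral_mul_const _ hf]
      exact mul_ne_zero (hmem Q hQ).2.1 (ENNReal.inv_ne_zero.2 hNt))
    (fun Q hQ => by
      rw [lintegral_mul_const _ hg]
      exact mul_ne_zero (hmem Q hQ).2.2 (ENNReal.inv_ne_zero.2 hMt))
    (fun Q hQ => div_pos (hl Q (hSS hQ)) hD)
    (fun Q hQ => by
      rw [← Finset.sum_div, ← mul_div_assoc]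
      refine div_le_div_of_nonneg_right (le_trans ?_ (hlsum Q (hSS hQ))) hD.le
      refine Finset.sum_le_sum_of_subset_of_nonneg (Finset.filter_subset_filter _ hSS) ?_
      exact fun R hR _ => (hl R (Finset.mem_filter.1 hR).1).le)
    (fun Q hQ => htail hqr.pos Q (hA Q (hSS hQ) (hmem Q hQ).1.1))
    (fun Q hQ => htail hpp.symm.pos Q (hB Q (hSS hQ) (hmem Q hQ).1.2))
    (hnorm hpp.pos hf hN0 hNt) (hnorm hqr.symm.pos hg hM0 hMt)
  have e : ∑ Q ∈ S', ENNReal.ofReal (l Q) * (∫⁻ x in Q, f x ∂μ) * (∫⁻ x in Q, g x ∂ν) =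
      ENNReal.ofReal D * N * M * ∑ Q ∈ S', ENNReal.ofReal (l Q / D) *
        (∫⁻ x in Q, f x * N⁻¹ ∂μ) * (∫⁻ x in Q, g x * M⁻¹ ∂ν) := by
    rw [Finset.mul_sum]
    refine Finset.sum_congr rfl fun Q _ => ?_
    rw [lintegral_mul_const _ hf, lintegral_mul_const _ hg, ENNReal.ofReal_div_of_pos hD,
      div_eq_mul_inv]
    calc _ = ENNReal.ofReal (l Q) * (∫⁻ x in Q, f x ∂μ) * (∫⁻ x in Q, g x ∂ν) *
          (ENNReal.ofReal D * (ENNReal.ofReal D)⁻¹) * (N * N⁻¹) * (M * M⁻¹) := by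
          rw [ENNReal.mul_inv_cancel hD0 ENNReal.ofReal_ne_top, ENNReal.mul_inv_cancel hN0 hNt,
            ENNReal.mul_inv_cancel hM0 hMt]; simp
      _ = _ := by ring
  rw [hsum, e]
  calc _ ≤ ENNReal.ofReal D * N * M * ENNReal.ofReal C := by gcongr
    _ = _ := by rw [ENNReal.ofReal_mul hC.le]; ring

/-- The relative offset of the shifted dyadic intervals of length `2 ^ k`. -/
def gridOff (b : Bool) (k : ℤ) : ℝ := if b then (-1) ^ k / 3 else 0

/-- The index of the shifted dyadic interval of length `2 ^ k` containing `t`. -/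
def gridIdx (b : Bool) (k : ℤ) (t : ℝ) : ℤ := ⌊t / 2 ^ k - gridOff b k⌋

/-- A cube of the dyadic grid with shift `b`. -/
def gridCube {n : ℕ} (b : Fin n → Bool) (k : ℤ) (N : Fin n → ℤ) : Cube n where
  corner i := 2 ^ k * (N i + gridOff (b i) k)
  side := 2 ^ k
  side_pos := by positivity

lemma mem_gridCube {n : ℕ} {b : Fin n → Bool} {k : ℤ} {N : Fin n → ℤ} {x : Rn n} :
    x ∈ (gridCube b k N).set ↔ ∀ i, gridIdx (b i) k (x i) = N i := by
  refine forall_congr' fun i => ?_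
  have h2 : (0 : ℝ) < 2 ^ k := by positivity
  simp only [gridCube, gridIdx]
  rw [Int.floor_eq_iff, le_sub_iff_add_le, le_div_iff₀ h2, sub_lt_iff_lt_add, div_lt_iff₀ h2]
  constructor <;> rintro ⟨h, h'⟩ <;> constructor <;> linarith

lemma exists_gridIdx_succ (b : Bool) (k : ℤ) : ∃ e : ℤ, ∀ t : ℝ,
    gridIdx b (k + 1) t = (gridIdx b k t + e) / 2 := by
  have h2 : (2 : ℝ) ^ k ≠ 0 := by positivity
  obtain ⟨e, he⟩ : ∃ e : ℤ, (e : ℝ) / 2 = gridOff b k / 2 - gridOff b (k + 1) := by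
    cases b
    · exact ⟨0, by simp [gridOff]⟩
    · refine ⟨(-1) ^ k.natAbs, ?_⟩
      have : ((-1 : ℝ)) ^ k = (-1) ^ k.natAbs := by
        rcases Int.natAbs_eq k with h | h
        · conv_lhs => rw [h]
          rw [zpow_natCast]
        · conv_lhs => rw [h]
          rw [zpow_neg, zpow_natCast, ← inv_pow]
          norm_num
      simp only [gridOff, if_true]
      rw [zpow_add_one₀ (by norm_num), this]
      push_cast
      ring
  refine ⟨e, fun t => ?_⟩
  have h1 : t / 2 ^ (k + 1) - gridOff b (k + 1) = (t / 2 ^ k - gridOff b k + e) / 2 := by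
    rw [add_div, he, zpow_add_one₀ (by norm_num)]
    field_simp
    ring
  rw [gridIdx, gridIdx, h1, ← Int.floor_add_intCast]
  exact_mod_cast Int.floor_div_natCast (_ : ℝ) 2

lemma gridIdx_eq_of_le {b : Bool} {k m : ℤ} (hkm : k ≤ m) {s t : ℝ}
    (h : gridIdx b k s = gridIdx b k t) : gridIdx b m s = gridIdx b m t := by
  induction m, hkm using Int.leInduction with
  | base => exact h
  | succ m _ ih =>
    obtain ⟨e, he⟩ := exists_gridIdx_succ b m
    rw [he, he, ih]

lemma exists_gridIdx_eq {k : ℤ} {s t : ℝ} (h : |s - t| < 2 ^ k / 3) :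
    ∃ b, gridIdx b k s = gridIdx b k t := by
  wlog hst : s ≤ t generalizing s t
  · obtain ⟨b, hb⟩ := this (by rwa [abs_sub_comm]) (not_le.1 hst).le
    exact ⟨b, hb.symm⟩
  have h2 : (0 : ℝ) < 2 ^ k := by positivity
  set x := s / 2 ^ k with hx
  set y := t / 2 ^ k with hy
  have hxy : x ≤ y := by rw [hx, hy]; gcongr
  have hd : y - x < 1 / 3 := by
    rw [abs_sub_comm, abs_of_nonneg (by linarith)] at h
    rw [hx, hy, ← sub_div, div_lt_iff₀ h2]
    linarith
  by_cases hfl : ⌊x⌋ = ⌊y⌋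
  · exact ⟨false, by simpa [gridIdx, gridOff] using hfl⟩
  · have hlt : ⌊x⌋ < ⌊y⌋ := lt_of_le_of_ne (Int.floor_le_floor hxy) hfl
    set m := ⌊y⌋ with hm
    have hm1 : (m : ℝ) ≤ y := Int.floor_le y
    have hm2 : x < m := Int.floor_lt.1 hlt
    refine ⟨true, ?_⟩
    simp only [gridIdx, gridOff, if_true, ← hx, ← hy]
    rcases Int.even_or_odd k with hk | hk
    · rw [hk.neg_one_zpow]
      trans m - 1
      · rw [Int.floor_eq_iff]; push_cast; constructor <;> linarith
      · symm; rw [Int.floor_eq_iff]; push_cast; constructor <;> linarith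
    · rw [hk.neg_one_zpow]
      trans m
      · rw [Int.floor_eq_iff]; constructor <;> linarith
      · symm; rw [Int.floor_eq_iff]; constructor <;> linarith

lemma Cube.set_eq_pi {n : ℕ} (Q : Cube n) :
    Q.set = Set.pi univ fun i => Ico (Q.corner i) (Q.corner i + Q.side) := by
  ext x; simp [Cube.set]

lemma Cube.measurableSet {n : ℕ} (Q : Cube n) : MeasurableSet Q.set := by
  rw [Q.set_eq_pi]
  exact MeasurableSet.univ_pi fun i => measurableSet_Ico

lemma Cube.vol_pos {n : ℕ} (Q : Cube n) : 0 < Q.vol := pow_pos Q.side_pos n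

lemma Cube.volume_set {n : ℕ} (Q : Cube n) : volume Q.set = ENNReal.ofReal Q.vol := by
  rw [Q.set_eq_pi, Real.volume_pi_Ico]
  simp [Cube.vol, ENNReal.ofReal_pow Q.side_pos.le]

lemma Cube.corner_mem {n : ℕ} (Q : Cube n) : Q.corner ∈ Q.set :=
  fun _ => ⟨le_rfl, by linarith [Q.side_pos]⟩

/-- The sets underlying the cubes of the grid with shift `b`. -/
def IsGridSet {n : ℕ} (b : Fin n → Bool) (Q : Set (Rn n)) : Prop :=
  ∃ k N, Q = (gridCube b k N).set

/-- The coefficient `|Q| ^ (α / n - 1)`. -/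
def lam {n : ℕ} (α : ℝ) (Q : Set (Rn n)) : ℝ := (volume Q).toReal ^ (α / n - 1)

lemma Cube.lam_set {n : ℕ} (α : ℝ) (Q : Cube n) : lam α Q.set = Q.vol ^ (α / n - 1) := by
  rw [lam, Q.volume_set, ENNReal.toReal_ofReal Q.vol_pos.le]

lemma lam_gridCube {n : ℕ} (hn : 0 < n) (α : ℝ) (b : Fin n → Bool) (k : ℤ) (N : Fin n → ℤ) :
    lam α (gridCube b k N).set = (2 : ℝ) ^ ((k : ℝ) * (α - n)) := by
  have hn0 : (n : ℝ) ≠ 0 := by positivity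
  rw [Cube.lam_set, Cube.vol]
  change (((2 : ℝ) ^ k) ^ n) ^ (α / n - 1) = _
  rw [← Real.rpow_intCast, ← Real.rpow_natCast,
    ← Real.rpow_mul (by positivity), ← Real.rpow_mul (by positivity)]
  congr 1
  field_simp

lemma gridCube_subset {n : ℕ} {b : Fin n → Bool} {k m : ℤ} (hkm : k ≤ m) {N M : Fin n → ℤ}
    {z : Rn n} (hz : z ∈ (gridCube b k N).set) (hz' : z ∈ (gridCube b m M).set) :
    (gridCube b k N).set ⊆ (gridCube b m M).set := by
  intro x hx
  rw [mem_gridCube] at *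
  intro i
  rw [← hz' i]
  exact gridIdx_eq_of_le hkm ((hx i).trans (hz i).symm)

lemma laminar_of_isGridSet {n : ℕ} {b : Fin n → Bool} {S : Finset (Set (Rn n))}
    (hS : ∀ Q ∈ S, IsGridSet b Q) : Laminar S := by
  intro Q hQ R hR
  obtain ⟨k, N, rfl⟩ := hS Q hQ
  obtain ⟨m, M, rfl⟩ := hS R hR
  by_cases hd : Disjoint (gridCube b k N).set (gridCube b m M).set
  · exact Or.inr (Or.inr hd)
  · obtain ⟨z, hz, hz'⟩ := Set.not_disjoint_iff.1 hd
    rcases le_total k m with h | h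
    · exact Or.inl (gridCube_subset h hz hz')
    · exact Or.inr (Or.inl (gridCube_subset h hz' hz))

lemma lam_pos_of_isGridSet {n : ℕ} {b : Fin n → Bool} (α : ℝ) {Q : Set (Rn n)}
    (hQ : IsGridSet b Q) : 0 < lam α Q := by
  obtain ⟨k, N, rfl⟩ := hQ
  rw [Cube.lam_set]
  exact Real.rpow_pos_of_pos (Cube.vol_pos _) _

lemma gridCube_injective {n : ℕ} (hn : 0 < n) (b : Fin n → Bool) :
    Function.Injective fun j : ℤ × (Fin n → ℤ) => (gridCube b j.1 j.2).set := by
  rintro ⟨k, N⟩ ⟨m, M⟩ h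
  simp only at h
  have hk : k = m := by
    have h1 := congrArg (lam (n + 1 : ℝ)) h
    rw [lam_gridCube hn, lam_gridCube hn] at h1
    simp only [add_sub_cancel_left, mul_one, Real.rpow_intCast] at h1
    exact zpow_right_injective₀ (by norm_num) (by norm_num) h1
  subst hk
  have h1 := (gridCube b k N).corner_mem
  have h2 := h ▸ h1
  rw [mem_gridCube] at h1 h2
  ext
  · rfl
  · exact (h1 _).symm.trans (h2 _)

/-- Cubes of one grid that share a point have geometrically varying coefficients. -/
lemma exists_sum_lam_rpow_le {n : ℕ} (hn : 0 < n) {α s : ℝ} (hα : α < n) (hs : 0 < s) :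
    ∃ C : ℝ, 0 < C ∧ ∀ (b : Fin n → Bool) (T : Finset (Set (Rn n))) (x : Rn n) (y : ℝ), 0 ≤ y →
      (∀ R ∈ T, IsGridSet b R) → (∀ R ∈ T, x ∈ R) → (∀ R ∈ T, lam α R ≤ y) →
      ∑ R ∈ T, lam α R ^ s ≤ C * y ^ s := by
  have hd : 0 < n - α := by linarith
  obtain ⟨C, hC, h⟩ := exists_geometric_sum_le (ε := (n - α) * s) (by positivity)
  refine ⟨C, hC, ?_⟩
  intro b T x y hy hT hx hle
  choose! k N hkN using hT
  have hlam : ∀ R ∈ T, lam α R = (2 : ℝ) ^ (((-k R : ℤ) : ℝ) * (n - α)) := by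
    intro R hR
    conv_lhs => rw [hkN R hR, lam_gridCube hn]
    congr 1
    push_cast; ring
  have hinj : Set.InjOn (fun R => -k R) (T : Set (Set (Rn n))) := by
    intro R hR R' hR' hRR
    have hk : k R = k R' := neg_injective hRR
    have h1 := hx R hR
    have h2 := hx R' hR'
    rw [hkN R hR, hkN R' hR', ← hk]
    rw [hkN R hR, mem_gridCube] at h1
    rw [hkN R' hR', mem_gridCube, ← hk] at h2
    rw [show N R = N R' from funext fun i => (h1 i).symm.trans (h2 i)]
  have := h (T.image fun R => -k R) (y ^ (1 / (n - α))) (by positivity) ?_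
  · rw [Finset.sum_image hinj, ← Real.rpow_mul hy] at this
    refine le_trans (le_of_eq (Finset.sum_congr rfl fun R hR => ?_)) (this.trans_eq ?_)
    · rw [hlam R hR, ← Real.rpow_mul (by norm_num), mul_assoc]
    · congr 2; field_simp
  · intro t ht
    obtain ⟨R, hR, rfl⟩ := Finset.mem_image.1 ht
    have h3 := hle R hR
    rw [hlam R hR, Real.rpow_mul (by norm_num)] at h3
    have h4 := Real.rpow_le_rpow (by positivity) h3 (by positivity : 0 ≤ 1 / (n - α))
    rwa [← Real.rpow_mul (by positivity), mul_one_div_cancel hd.ne', Real.rpow_one] at h4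

lemma norm_le_eucNorm {n : ℕ} (x : Rn n) : ‖x‖ ≤ eucNorm x := by
  refine (pi_norm_le_iff_of_nonneg (Real.sqrt_nonneg _)).2 ?_
  intro i
  rw [Real.norm_eq_abs, ← Real.sqrt_sq_eq_abs]
  exact Real.sqrt_le_sqrt (Finset.single_le_sum (f := fun i => x i ^ 2)
    (fun i _ => sq_nonneg _) (Finset.mem_univ i))

/-- The Riesz kernel is dominated by finitely many dyadic kernels. -/
lemma riesz_kernel_le {n : ℕ} (hn : 0 < n) {α : ℝ} (hα : α < n) {x y : Rn n} (hxy : x ≠ y) :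
    ENNReal.ofReal (eucNorm (x - y) ^ (α - n)) ≤ ENNReal.ofReal (6 ^ (n - α)) *
      ∑ b : Fin n → Bool, ∑' j : ℤ × (Fin n → ℤ),
        ENNReal.ofReal (lam α (gridCube b j.1 j.2).set) *
          ((gridCube b j.1 j.2).set.indicator 1 x * (gridCube b j.1 j.2).set.indicator 1 y) := by
  have hd : 0 < ‖x - y‖ := norm_pos_iff.2 (sub_ne_zero.2 hxy)
  obtain ⟨k, hk1, hk2⟩ := exists_mem_Ico_zpow (show 0 < 3 * ‖x - y‖ by positivity)
    (one_lt_two (α := ℝ))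
  have hb : ∀ i, ∃ b, gridIdx b (k + 1) (x i) = gridIdx b (k + 1) (y i) := by
    intro i
    apply exists_gridIdx_eq
    have := norm_le_pi_norm (x - y) i
    rw [Real.norm_eq_abs, Pi.sub_apply] at this
    linarith
  choose b hb using hb
  set Q := (gridCube b (k + 1) fun i => gridIdx (b i) (k + 1) (x i)).set with hQ
  have hxQ : x ∈ Q := mem_gridCube.2 fun i => rfl
  have hyQ : y ∈ Q := mem_gridCube.2 fun i => (hb i).symm
  calc ENNReal.ofReal (eucNorm (x - y) ^ (α - n))
      ≤ ENNReal.ofReal (6 ^ (n - α) * lam α Q) := by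
        refine ENNReal.ofReal_le_ofReal ?_
        rw [hQ, lam_gridCube hn]
        have h1 : (2 : ℝ) ^ ((k + 1 : ℤ) : ℝ) / 6 ≤ eucNorm (x - y) := by
          refine le_trans ?_ (norm_le_eucNorm _)
          rw [Real.rpow_intCast, zpow_add_one₀ (by norm_num)]
          linarith
        refine (Real.rpow_le_rpow_of_nonpos (by positivity) h1 (by linarith)).trans_eq ?_
        rw [Real.div_rpow (by positivity) (by norm_num), ← Real.rpow_mul (by norm_num),
          div_eq_mul_inv, ← Real.rpow_neg (by norm_num), neg_sub, mul_comm]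
    _ = ENNReal.ofReal (6 ^ (n - α)) * (ENNReal.ofReal (lam α Q) *
          (Q.indicator 1 x * Q.indicator 1 y)) := by
        rw [indicator_of_mem hxQ, indicator_of_mem hyQ, ENNReal.ofReal_mul (by positivity)]
        simp
    _ ≤ _ := by
        gcongr
        refine le_trans ?_ (Finset.single_le_sum (fun _ _ => zero_le) (Finset.mem_univ b))
        exact ENNReal.le_tsum (f := fun j : ℤ × (Fin n → ℤ) =>
          ENNReal.ofReal (lam α (gridCube b j.1 j.2).set) *
          ((gridCube b j.1 j.2).set.indicator 1 x * (gridCube b j.1 j.2).set.indicator 1 y))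
          (k + 1, fun i => gridIdx (b i) (k + 1) (x i))

/-- The measure with density `w`. -/
def weightMeasure {n : ℕ} (w : Rn n → ℝ) : Measure (Rn n) :=
  volume.withDensity fun x => ENNReal.ofReal (w x)

lemma lintegral_weightMeasure {n : ℕ} {w : Rn n → ℝ} (hw : Measurable w) (f : Rn n → ℝ≥0∞) :
    ∫⁻ x, f x ∂weightMeasure w = ∫⁻ x, f x * ENNReal.ofReal (w x) := by
  rw [weightMeasure, lintegral_withDensity_eq_lintegral_mul_non_measurable _ hw.ennreal_ofReal
    (Filter.Eventually.of_forall fun _ => ENNReal.ofReal_lt_top)]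
  simp [mul_comm]

lemma setLIntegral_weightMeasure {n : ℕ} {w : Rn n → ℝ} (hw : Measurable w) (f : Rn n → ℝ≥0∞)
    {Q : Set (Rn n)} (hQ : MeasurableSet Q) :
    ∫⁻ x in Q, f x ∂weightMeasure w = ∫⁻ x in Q, mulW f w x := by
  rw [weightMeasure, setLIntegral_withDensity_eq_setLIntegral_mul_non_measurable _
    hw.ennreal_ofReal _ hQ (Filter.Eventually.of_forall fun _ => ENNReal.ofReal_lt_top)]
  simp [mulW, mul_comm]

lemma LpW_eq {n : ℕ} {w : Rn n → ℝ} (hw : Measurable w) (f : Rn n → ℝ≥0∞) (p : ℝ) :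
    LpW f p w = (∫⁻ x, f x ^ p ∂weightMeasure w) ^ (1 / p) := by
  rw [LpW, lintegral_weightMeasure hw]

lemma IsWeight.cube_ne_top {n : ℕ} {w : Rn n → ℝ} (hw : IsWeight w) (Q : Cube n) :
    weightMeasure w Q.set ≠ ∞ := by
  have h1 : Q.set ⊆ Icc Q.corner fun i => Q.corner i + Q.side :=
    fun x hx => ⟨fun i => (hx i).1, fun i => (hx i).2.le⟩
  have h2 : IntegrableOn w Q.set := (hw.2.2.integrableOn_isCompact isCompact_Icc).mono_set h1
  rw [weightMeasure, withDensity_apply _ Q.measurableSet]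
  exact h2.lintegral_lt_top.ne

instance {n : ℕ} (w : Rn n → ℝ) : SigmaFinite (weightMeasure w) :=
  SigmaFinite.withDensity_ofReal _

lemma opNormStrong_le {n : ℕ} {T : (Rn n → ℝ≥0∞) → Rn n → ℝ≥0∞} {p q : ℝ} {σ u : Rn n → ℝ}
    {K : ℝ≥0∞} (h : ∀ f : Rn n → ℝ≥0∞, Measurable f → LpW f p σ ≠ ∞ →
      LpW (T (mulW f σ)) q u ≤ K * LpW f p σ) : opNormStrong T p q σ u ≤ K := by
  refine iSup₂_le fun f hf => ?_
  rcases eq_or_ne (LpW f p σ) ∞ with ht | ht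
  · rw [ht, ENNReal.div_top]; exact zero_le
  · exact ENNReal.div_le_of_le_mul (h f hf ht)

lemma LpW_le_opNormStrong_mul {n : ℕ} {T : (Rn n → ℝ≥0∞) → Rn n → ℝ≥0∞} {p q : ℝ}
    {σ u : Rn n → ℝ} {f : Rn n → ℝ≥0∞} (hf : Measurable f) (ht : LpW f p σ ≠ ∞)
    (h0 : LpW f p σ = 0 → LpW (T (mulW f σ)) q u = 0) :
    LpW (T (mulW f σ)) q u ≤ opNormStrong T p q σ u * LpW f p σ := by
  rcases eq_or_ne (LpW f p σ) 0 with h | h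
  · rw [h0 h]; exact zero_le
  · rw [← ENNReal.div_le_iff h ht]
    exact le_iSup₂ (f := fun (f : Rn n → ℝ≥0∞) (_ : Measurable f) =>
      LpW (T (mulW f σ)) q u / LpW f p σ) f hf

lemma opNormStrong_mono {n : ℕ} {T T' : (Rn n → ℝ≥0∞) → Rn n → ℝ≥0∞} {p q : ℝ}
    {σ u : Rn n → ℝ} {c : ℝ≥0∞} (hq : 0 < q) (hc : c ≠ ∞)
    (h : ∀ f x, T f x ≤ c * T' f x) :
    opNormStrong T p q σ u ≤ c * opNormStrong T' p q σ u := by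
  refine iSup₂_le fun f hf => ?_
  have h1 : LpW (T (mulW f σ)) q u ≤ c * LpW (T' (mulW f σ)) q u := by
    calc _ ≤ (∫⁻ x, c ^ q * (T' (mulW f σ) x ^ q * ENNReal.ofReal (u x))) ^ (1 / q) := by
          rw [LpW]
          refine ENNReal.rpow_le_rpow (lintegral_mono fun x => ?_) (by positivity)
          rw [← mul_assoc, ← ENNReal.mul_rpow_of_nonneg _ _ hq.le]
          gcongr
          exact h _ _
      _ = _ := by
          rw [lintegral_const_mul' _ _ (ENNReal.rpow_ne_top_of_nonneg hq.le hc),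
            ENNReal.mul_rpow_of_nonneg _ _ (by positivity), ← ENNReal.rpow_mul,
            mul_one_div_cancel hq.ne', ENNReal.rpow_one, LpW]
  calc _ ≤ c * LpW (T' (mulW f σ)) q u / LpW f p σ := by gcongr
    _ = c * (LpW (T' (mulW f σ)) q u / LpW f p σ) := mul_div_assoc _ _ _
    _ ≤ _ := by
        gcongr
        exact le_iSup₂ (f := fun (f : Rn n → ℝ≥0∞) (_ : Measurable f) =>
          LpW (T' (mulW f σ)) q u / LpW f p σ) f hf

/-- Duality: an `L^q` norm is determined by pairings with functions of finite `L^r` norm. -/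
lemma lintegral_rpow_le_of_forall_pairing {X : Type*} [MeasurableSpace X] {ν : Measure X}
    [SigmaFinite ν] {q r : ℝ} (hqr : q.HolderConjugate r) {T : X → ℝ≥0∞} {K : ℝ≥0∞}
    (h : ∀ g : X → ℝ≥0∞, Measurable g → ∫⁻ x, g x ^ r ∂ν ≠ ∞ →
      ∫⁻ x, T x * g x ∂ν ≤ K * (∫⁻ x, g x ^ r ∂ν) ^ (1 / r)) :
    (∫⁻ x, T x ^ q ∂ν) ^ (1 / q) ≤ K := by
  have hq := hqr.pos
  have hr := hqr.symm.pos
  by_contra! hcon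
  have h1 : K ^ q < ∫⁻ x, T x ^ q ∂ν := by
    have := ENNReal.rpow_lt_rpow hcon hq
    rwa [← ENNReal.rpow_mul, one_div_mul_cancel hq.ne', ENNReal.rpow_one] at this
  rw [lintegral_eq_nnreal] at h1
  obtain ⟨ψ, hψ⟩ := lt_iSup_iff.1 h1
  obtain ⟨hψT, hψ⟩ := lt_iSup_iff.1 hψ
  rw [← SimpleFunc.lintegral_eq_lintegral] at hψ
  obtain ⟨φ, hφψ, hφt, hlt⟩ := SimpleFunc.exists_lt_lintegral_simpleFunc_of_lt_lintegral hψ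
  have hφ : ∀ x, (φ x : ℝ≥0∞) ≤ T x ^ q := fun x =>
    (ENNReal.coe_le_coe.2 (hφψ x)).trans (hψT x)
  set J := ∫⁻ x, (φ x : ℝ≥0∞) ∂ν with hJ
  have hφm : Measurable fun x => (φ x : ℝ≥0∞) := φ.measurable.coe_nnreal_ennreal
  have e : ∀ x, ((φ x : ℝ≥0∞) ^ (1 / r)) ^ r = φ x := by
    intro x
    rw [← ENNReal.rpow_mul, one_div_mul_cancel hr.ne', ENNReal.rpow_one]
  have h2 := h (fun x => (φ x : ℝ≥0∞) ^ (1 / r)) (hφm.pow_const _) (by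
    simp_rw [e]; exact hφt.ne)
  simp_rw [e] at h2
  have h3 : J ≤ K * J ^ (1 / r) := by
    refine le_trans (lintegral_mono fun x => ?_) h2
    have h4 : (φ x : ℝ≥0∞) ^ (1 / q) ≤ T x := by
      have := ENNReal.rpow_le_rpow (hφ x) (by positivity : 0 ≤ 1 / q)
      rwa [← ENNReal.rpow_mul, mul_one_div_cancel hq.ne', ENNReal.rpow_one] at this
    calc (φ x : ℝ≥0∞) = (φ x : ℝ≥0∞) ^ (1 / q) * (φ x : ℝ≥0∞) ^ (1 / r) := by
          rw [← ENNReal.rpow_add_of_nonneg _ _ (by positivity) (by positivity), one_div, one_div,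
            hqr.inv_add_inv_eq_one, ENNReal.rpow_one]
      _ ≤ _ := by gcongr
  have hJ0 : J ≠ 0 := (zero_le.trans_lt hlt).ne'
  have hJr0 : J ^ (1 / r) ≠ 0 := by
    rw [Ne, ENNReal.rpow_eq_zero_iff_of_pos (by positivity)]; exact hJ0
  have hJrt : J ^ (1 / r) ≠ ∞ := ENNReal.rpow_ne_top_of_nonneg (by positivity) hφt.ne
  have h5 : J = J ^ (1 / q) * J ^ (1 / r) := by
    rw [← ENNReal.rpow_add_of_nonneg _ _ (by positivity) (by positivity), one_div, one_div,
      hqr.inv_add_inv_eq_one, ENNReal.rpow_one]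
  rw [h5] at h3
  have h6 : J ^ (1 / q) ≤ K := by
    have : J ^ (1 / q) * J ^ (1 / r) ≤ K * J ^ (1 / r) := by
      rwa [← h5] at h3 ⊢
    exact (ENNReal.mul_le_mul_iff_left hJr0 hJrt).1 this
  have h7 := ENNReal.rpow_le_rpow h6 hq.le
  rw [← ENNReal.rpow_mul, one_div_mul_cancel hq.ne', ENNReal.rpow_one] at h7
  exact absurd hlt (not_lt.2 h7)

/-- Cubes of one grid that share a point have geometrically varying coefficients. -/
lemma exists_sum_ofReal_lam_rpow_le {n : ℕ} (hn : 0 < n) {α s : ℝ} (hα : α < n) (hs : 0 < s) :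
    ∃ C : ℝ, 0 < C ∧ ∀ (b : Fin n → Bool) (T : Finset (Set (Rn n))) (x : Rn n) (y : ℝ≥0∞),
      (∀ R ∈ T, IsGridSet b R) → (∀ R ∈ T, x ∈ R) → (∀ R ∈ T, ENNReal.ofReal (lam α R) ≤ y) →
      ∑ R ∈ T, ENNReal.ofReal (lam α R) ^ s ≤ ENNReal.ofReal C * y ^ s := by
  obtain ⟨C, hC, h⟩ := exists_sum_lam_rpow_le hn hα hs
  refine ⟨C, hC, ?_⟩
  intro b T x y hT hx hle
  rcases eq_or_ne y ∞ with rfl | hy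
  · rw [ENNReal.top_rpow_of_pos hs, ENNReal.mul_top (ENNReal.ofReal_pos.2 hC).ne']
    exact le_top
  lift y to NNReal using hy
  have := h b T x y y.coe_nonneg hT hx fun R hR => by
    have := hle R hR
    rwa [← ENNReal.ofReal_coe_nnreal, ENNReal.ofReal_le_ofReal_iff y.coe_nonneg] at this
  rw [← ENNReal.ofReal_coe_nnreal, ENNReal.ofReal_rpow_of_nonneg y.coe_nonneg hs.le,
    ← ENNReal.ofReal_mul hC.le]
  refine le_trans (le_of_eq ?_) (ENNReal.ofReal_le_ofReal this)
  rw [ENNReal.ofReal_sum_of_nonneg fun R hR =>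
    Real.rpow_nonneg (lam_pos_of_isGridSet α (hT R hR)).le _]
  refine Finset.sum_congr rfl fun R hR => ?_
  rw [ENNReal.ofReal_rpow_of_nonneg (lam_pos_of_isGridSet α (hT R hR)).le hs.le]

lemma lam_mul_le_fracMax {n : ℕ} (α : ℝ) {w : Rn n → ℝ} {Q : Set (Rn n)}
    (hQ : MeasurableSet Q) (R : Cube n) (hQR : Q ⊆ R.set) {x : Rn n} (hx : x ∈ R.set) :
    ENNReal.ofReal (lam α R.set) * weightMeasure w Q ≤
      fracMax α (mulW (Q.indicator 1) w) x := by
  refine le_trans ?_ (le_iSup₂ (f := fun (R : Cube n) (_ : x ∈ R.set) =>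
    ENNReal.ofReal (R.vol ^ (α / n - 1)) * ∫⁻ y in R.set, mulW (Q.indicator 1) w y) R hx)
  rw [R.lam_set]
  gcongr
  rw [weightMeasure, withDensity_apply _ hQ]
  calc _ ≤ ∫⁻ y in Q, mulW (Q.indicator 1) w y := by
        refine setLIntegral_mono' hQ fun y hy => ?_
        simp [mulW, hy]
    _ ≤ _ := lintegral_mono_set hQR

open scoped Classical in
/-- Testing the maximal operator on indicators of cubes gives the tail condition. -/
lemma exists_tail_le {n : ℕ} (hn : 0 < n) {α q : ℝ} (hα : α < n) (hq : 0 < q) :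
    ∃ C : ℝ, 0 < C ∧ ∀ {p : ℝ} {σ u : Rn n → ℝ}, 0 < p → IsWeight σ → IsWeight u →
      ∀ (b : Fin n → Bool) (S : Finset (Set (Rn n))), (∀ R ∈ S, IsGridSet b R) →
      ∀ Q ∈ S, weightMeasure σ Q ≠ 0 →
        (∑ R ∈ S with Q ⊆ R, ENNReal.ofReal (lam α R) ^ q * weightMeasure u R) *
          weightMeasure σ Q ^ (q * (1 - 1 / p)) ≤
        ENNReal.ofReal C * opNormStrong (fracMax α) p q σ u ^ q := by
  obtain ⟨C, hC, h⟩ := exists_sum_ofReal_lam_rpow_le hn hα hq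
  refine ⟨C, hC, ?_⟩
  intro p σ u hp hσ hu b S hS Q hQ hQ0
  set A := opNormStrong (fracMax α) p q σ u with hA
  set m := weightMeasure σ Q with hm
  have hmeas : ∀ R ∈ S, MeasurableSet R := by
    intro R hR
    obtain ⟨k, N, rfl⟩ := hS R hR
    exact Cube.measurableSet _
  have hmt : m ≠ ∞ := by
    obtain ⟨k, N, hkN⟩ := hS Q hQ
    rw [hm, hkN]
    exact hσ.cube_ne_top _
  have hne : ∀ s : ℝ, m ^ s ≠ 0 ∧ m ^ s ≠ ∞ := fun s =>
    ⟨(ENNReal.rpow_pos (pos_iff_ne_zero.2 hQ0) hmt).ne', ENNReal.rpow_ne_top_of_ne_zero hQ0 hmt⟩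
  set T := fracMax α (mulW (Q.indicator 1) σ) with hT
  have hnorm : LpW (Q.indicator 1) p σ = m ^ (1 / p) := by
    rw [LpW_eq hσ.1]
    congr 1
    have : ∀ x, Q.indicator (1 : Rn n → ℝ≥0∞) x ^ p = Q.indicator 1 x := by
      intro x
      by_cases hx : x ∈ Q <;> simp [hx, hp]
    simp_rw [this]
    exact lintegral_indicator_one (hmeas Q hQ)
  have htest : ∫⁻ x, T x ^ q ∂weightMeasure u ≤ A ^ q * m ^ (q / p) := by
    have h1 := LpW_le_opNormStrong_mul (T := fracMax α) (p := p) (q := q) (σ := σ) (u := u)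
      (f := Q.indicator 1) (measurable_one.indicator (hmeas Q hQ)) (by rw [hnorm]; exact (hne _).2)
      (fun h0 => by rw [hnorm] at h0; exact absurd h0 (hne _).1)
    rw [hnorm, LpW_eq hu.1] at h1
    have h2 := ENNReal.rpow_le_rpow h1 hq.le
    rw [← ENNReal.rpow_mul, one_div_mul_cancel hq.ne', ENNReal.rpow_one,
      ENNReal.mul_rpow_of_nonneg _ _ hq.le, ← ENNReal.rpow_mul] at h2
    rwa [show q / p = 1 / p * q by ring]
  have hpt : ∀ x, ∑ R ∈ S with Q ⊆ R, ENNReal.ofReal (lam α R) ^ q * R.indicator 1 x ≤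
      ENNReal.ofReal C * (T x / m) ^ q := by
    intro x
    refine le_trans (le_of_eq ?_) (h b ((S.filter (Q ⊆ ·)).filter (x ∈ ·)) x (T x / m)
      (fun R hR => hS R (Finset.mem_filter.1 (Finset.mem_filter.1 hR).1).1)
      (fun R hR => (Finset.mem_filter.1 hR).2) fun R hR => ?_)
    · rw [Finset.sum_filter (p := (x ∈ ·))]
      refine Finset.sum_congr rfl fun R _ => ?_
      by_cases hx : x ∈ R <;> simp [hx]
    · obtain ⟨hR1, hxR⟩ := Finset.mem_filter.1 hR
      obtain ⟨hRS, hQR⟩ := Finset.mem_filter.1 hR1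
      obtain ⟨k, N, rfl⟩ := hS R hRS
      rw [ENNReal.le_div_iff_mul_le (Or.inl hQ0) (Or.inl hmt)]
      exact lam_mul_le_fracMax α (hmeas Q hQ) _ hQR hxR
  have hsum_le : ∑ R ∈ S with Q ⊆ R, ENNReal.ofReal (lam α R) ^ q * weightMeasure u R ≤
      ENNReal.ofReal C * (A ^ q * m ^ (q / p)) / m ^ q := by
    calc _ = ∫⁻ x, ∑ R ∈ S with Q ⊆ R, ENNReal.ofReal (lam α R) ^ q * R.indicator 1 x
          ∂weightMeasure u := by
          rw [lintegral_finsetSum]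
          · refine Finset.sum_congr rfl fun R hR => ?_
            have hRm := hmeas R (Finset.mem_filter.1 hR).1
            rw [lintegral_const_mul _ (measurable_one.indicator hRm),
              lintegral_indicator_one hRm]
          · intro R hR
            exact (measurable_one.indicator (hmeas R (Finset.mem_filter.1 hR).1)).const_mul _
      _ ≤ ∫⁻ x, ENNReal.ofReal C * (m ^ q)⁻¹ * T x ^ q ∂weightMeasure u := by
          refine lintegral_mono fun x => (hpt x).trans_eq ?_
          rw [ENNReal.div_rpow_of_nonneg _ _ hq.le, div_eq_mul_inv]
          ring
      _ = ENNReal.ofReal C * (m ^ q)⁻¹ * ∫⁻ x, T x ^ q ∂weightMeasure u := by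
          rw [lintegral_const_mul' _ _ (ENNReal.mul_ne_top ENNReal.ofReal_ne_top
            (ENNReal.inv_ne_top.2 (hne q).1))]
      _ ≤ ENNReal.ofReal C * (m ^ q)⁻¹ * (A ^ q * m ^ (q / p)) := by gcongr
      _ = _ := by rw [ENNReal.div_eq_inv_mul (b := m ^ q)]; ring
  calc _ ≤ ENNReal.ofReal C * (A ^ q * m ^ (q / p)) / m ^ q * m ^ (q * (1 - 1 / p)) := by gcongr
    _ = ENNReal.ofReal C * A ^ q * (m ^ (q / p) * m ^ (q * (1 - 1 / p)) * (m ^ q)⁻¹) := by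
        rw [ENNReal.div_eq_inv_mul (b := m ^ q)]; ring
    _ = _ := by
        rw [← ENNReal.rpow_add _ _ hQ0 hmt, show q / p + q * (1 - 1 / p) = q by ring,
          ENNReal.mul_inv_cancel (hne q).1 (hne q).2, mul_one]

lemma riesz_le_sum_gridCube {n : ℕ} (hn : 0 < n) {α : ℝ} (hα : α < n) {h : Rn n → ℝ≥0∞}
    (hh : Measurable h) (x : Rn n) :
    riesz α h x ≤ ENNReal.ofReal (6 ^ (n - α)) * ∑ b : Fin n → Bool, ∑' j : ℤ × (Fin n → ℤ),
      ENNReal.ofReal (lam α (gridCube b j.1 j.2).set) *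
        ((∫⁻ y in (gridCube b j.1 j.2).set, h y) * (gridCube b j.1 j.2).set.indicator 1 x) := by
  have : Nonempty (Fin n) := ⟨⟨0, hn⟩⟩
  have hm : ∀ (b : Fin n → Bool) (j : ℤ × (Fin n → ℤ)),
      Measurable ((gridCube b j.1 j.2).set.indicator (1 : Rn n → ℝ≥0∞)) := fun b j =>
    measurable_one.indicator (Cube.measurableSet _)
  have hne : ∀ᵐ y : Rn n, x ≠ y := by
    have : ∀ᵐ y : Rn n, y ∈ ({x} : Set (Rn n))ᶜ := measure_eq_zero_iff_ae_notMem.1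
      (measure_singleton x)
    filter_upwards [this] with y hy hxy
    exact hy hxy.symm
  calc riesz α h x ≤ ∫⁻ y, ENNReal.ofReal (6 ^ (n - α)) *
        ∑ b : Fin n → Bool, ∑' j : ℤ × (Fin n → ℤ),
          ENNReal.ofReal (lam α (gridCube b j.1 j.2).set) *
          ((gridCube b j.1 j.2).set.indicator 1 x *
            (h y * (gridCube b j.1 j.2).set.indicator 1 y)) := by
        refine lintegral_mono_ae ?_
        filter_upwards [hne] with y hy
        refine (mul_le_mul_right (riesz_kernel_le hn hα hy) (h y)).trans_eq ?_
        rw [mul_left_comm, Finset.mul_sum]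
        congr 1
        refine Finset.sum_congr rfl fun b _ => ?_
        rw [← ENNReal.tsum_mul_left]
        refine tsum_congr fun j => ?_
        ring
    _ = _ := by
        rw [lintegral_const_mul' _ _ ENNReal.ofReal_ne_top, lintegral_finsetSum]
        · congr 1
          refine Finset.sum_congr rfl fun b _ => ?_
          rw [lintegral_tsum]
          · refine tsum_congr fun j => ?_
            have hhm : Measurable fun y => h y * (gridCube b j.1 j.2).set.indicator 1 y :=
              hh.mul (hm b j)
            rw [lintegral_const_mul' _ _ ENNReal.ofReal_ne_top, lintegral_const_mul _ hhm,
              mul_comm (∫⁻ y in _, h y)]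
            congr 2
            rw [← lintegral_indicator (Cube.measurableSet _)]
            refine lintegral_congr fun y => ?_
            by_cases hy : y ∈ (gridCube b j.1 j.2).set <;> simp [hy]
          · intro j
            exact (((hh.mul (hm b j)).const_mul _).const_mul _).aemeasurable
        · intro b _
          exact Measurable.tsum fun j => ((hh.mul (hm b j)).const_mul _).const_mul _

lemma lintegral_riesz_mul_le {n : ℕ} (hn : 0 < n) {α : ℝ} (hα : α < n) {σ u : Rn n → ℝ}
    (hσ : Measurable σ) {f g : Rn n → ℝ≥0∞} (hf : Measurable f) (hg : Measurable g) :
    ∫⁻ x, riesz α (mulW f σ) x * g x ∂weightMeasure u ≤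
      ENNReal.ofReal (6 ^ (n - α)) * ∑ b : Fin n → Bool, ∑' j : ℤ × (Fin n → ℤ),
        ENNReal.ofReal (lam α (gridCube b j.1 j.2).set) *
          (∫⁻ x in (gridCube b j.1 j.2).set, f x ∂weightMeasure σ) *
          (∫⁻ x in (gridCube b j.1 j.2).set, g x ∂weightMeasure u) := by
  have hm : ∀ (b : Fin n → Bool) (j : ℤ × (Fin n → ℤ)), Measurable fun x =>
      (gridCube b j.1 j.2).set.indicator (1 : Rn n → ℝ≥0∞) x * g x := fun b j =>
    (measurable_one.indicator (Cube.measurableSet _)).mul hg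
  have hfσ : Measurable (mulW f σ) := hf.mul hσ.ennreal_ofReal
  calc _ ≤ ∫⁻ x, ENNReal.ofReal (6 ^ (n - α)) *
        ∑ b : Fin n → Bool, ∑' j : ℤ × (Fin n → ℤ),
          ENNReal.ofReal (lam α (gridCube b j.1 j.2).set) *
          (∫⁻ x in (gridCube b j.1 j.2).set, f x ∂weightMeasure σ) *
            ((gridCube b j.1 j.2).set.indicator 1 x * g x) ∂weightMeasure u := by
        refine lintegral_mono fun x => ?_
        refine (mul_le_mul_left (riesz_le_sum_gridCube hn hα hfσ x) (g x)).trans_eq ?_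
        rw [mul_assoc, Finset.sum_mul]
        congr 1
        refine Finset.sum_congr rfl fun b _ => ?_
        rw [← ENNReal.tsum_mul_right]
        refine tsum_congr fun j => ?_
        rw [setLIntegral_weightMeasure hσ _ (Cube.measurableSet _)]
        ring
    _ = _ := by
        rw [lintegral_const_mul' _ _ ENNReal.ofReal_ne_top, lintegral_finsetSum]
        · congr 1
          refine Finset.sum_congr rfl fun b _ => ?_
          rw [lintegral_tsum]
          · refine tsum_congr fun j => ?_
            rw [lintegral_const_mul _ (hm b j)]
            congr 1
            rw [← lintegral_indicator (Cube.measurableSet _)]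
            refine lintegral_congr fun y => ?_
            by_cases hy : y ∈ (gridCube b j.1 j.2).set <;> simp [hy]
          · intro j
            exact ((hm b j).const_mul _).aemeasurable
        · intro b _
          exact Measurable.tsum fun j => (hm b j).const_mul _

open scoped Classical in
lemma exists_sum_lam_le {n : ℕ} (hn : 0 < n) {α : ℝ} (hα : α < n) :
    ∃ K : ℝ, ∀ (b : Fin n → Bool) (S : Finset (Set (Rn n))), (∀ Q ∈ S, IsGridSet b Q) →
      ∀ Q ∈ S, ∑ R ∈ S with Q ⊆ R, lam α R ≤ K * lam α Q := by
  obtain ⟨K, -, h⟩ := exists_sum_lam_rpow_le hn hα one_pos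
  refine ⟨K, fun b S hS Q hQ => ?_⟩
  have hQ' := hS Q hQ
  obtain ⟨k, N, hkN⟩ := hS Q hQ
  have := h b (S.filter (Q ⊆ ·)) (gridCube b k N).corner (lam α Q)
    (lam_pos_of_isGridSet α hQ').le (fun R hR => hS R (Finset.mem_filter.1 hR).1)
    (fun R hR => (Finset.mem_filter.1 hR).2 (hkN ▸ Cube.corner_mem _)) fun R hR => ?_
  · simpa only [Real.rpow_one] using this
  · obtain ⟨hR, hQR⟩ := Finset.mem_filter.1 hR
    obtain ⟨m, M, rfl⟩ := hS R hR
    subst hkN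
    have hn0 : (0 : ℝ) < n := by positivity
    rw [Cube.lam_set, Cube.lam_set]
    refine Real.rpow_le_rpow_of_nonpos (Cube.vol_pos _) ?_ ?_
    · have := measure_mono (μ := volume) hQR
      rwa [Cube.volume_set, Cube.volume_set,
        ENNReal.ofReal_le_ofReal_iff (Cube.vol_pos _).le] at this
    · rw [sub_nonpos, div_le_one hn0]
      exact hα.le

/-- Both maximal operators together control the Riesz potential. -/
lemma exists_opNormStrong_riesz_le {n : ℕ} (hn : 0 < n) {α p q p' r : ℝ} (hα : α < n)
    (hp : 1 < p) (hpq : p < q) (hpp : p.HolderConjugate p') (hqr : q.HolderConjugate r) :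
    ∃ C : ℝ, 0 < C ∧ ∀ u σ : Rn n → ℝ, IsWeight u → IsWeight σ →
      opNormStrong (riesz α) p q σ u ≤ ENNReal.ofReal C *
        (opNormStrong (fracMax α) p q σ u + opNormStrong (fracMax α) r p' u σ) := by
  classical
  have hq := hqr.pos
  have hp' := hpp.symm.pos
  obtain ⟨K, hK⟩ := exists_sum_lam_le hn hα
  obtain ⟨C₀, hC₀, hbil⟩ := exists_laminar_bilinear_le (K := K) hp hpq hpp hqr
  obtain ⟨C₁, hC₁, htail₁⟩ := exists_tail_le hn hα hq
  obtain ⟨C₂, hC₂, htail₂⟩ := exists_tail_le hn hα hp'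
  set c := C₁ ^ (1 / q) + C₂ ^ (1 / p') with hc
  have hc0 : 0 < c := by positivity
  set C := 6 ^ (n - α) * (2 ^ n * (C₀ * c)) with hC
  have hC0 : 0 < C := by positivity
  refine ⟨C, hC0, ?_⟩
  intro u σ hu hσ
  set A := opNormStrong (fracMax α) p q σ u with hA
  set B := opNormStrong (fracMax α) r p' u σ with hB
  have key : ∀ D : ℝ, 0 < D → A + B ≤ ENNReal.ofReal D →
      opNormStrong (riesz α) p q σ u ≤ ENNReal.ofReal (C * D) := by
    intro D hD hAB
    have scale : ∀ {s E : ℝ} {N : ℝ≥0∞}, 0 < s → 0 < E → E ^ (1 / s) ≤ c →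
        N ≤ ENNReal.ofReal D → ENNReal.ofReal E * N ^ s ≤ ENNReal.ofReal (c * D) ^ s := by
      intro s E N hs hE hEc hN
      rw [ENNReal.ofReal_mul hc0.le, ENNReal.mul_rpow_of_nonneg _ _ hs.le]
      gcongr
      rw [ENNReal.ofReal_rpow_of_pos hc0]
      refine ENNReal.ofReal_le_ofReal ?_
      have := Real.rpow_le_rpow (by positivity) hEc hs.le
      rwa [← Real.rpow_mul hE.le, one_div_mul_cancel hs.ne', Real.rpow_one] at this
    refine opNormStrong_le fun f hf _ => ?_
    rw [LpW_eq hu.1]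
    refine lintegral_rpow_le_of_forall_pairing hqr fun g hg _ => ?_
    rw [LpW_eq hσ.1]
    set N := (∫⁻ x, f x ^ p ∂weightMeasure σ) ^ (1 / p)
    set M := (∫⁻ x, g x ^ r ∂weightMeasure u) ^ (1 / r)
    have hgrid : ∀ b : Fin n → Bool, ∑' j : ℤ × (Fin n → ℤ),
        ENNReal.ofReal (lam α (gridCube b j.1 j.2).set) *
          (∫⁻ x in (gridCube b j.1 j.2).set, f x ∂weightMeasure σ) *
          (∫⁻ x in (gridCube b j.1 j.2).set, g x ∂weightMeasure u) ≤
        ENNReal.ofReal (C₀ * (c * D)) * (N * M) := by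
      intro b
      rw [ENNReal.tsum_eq_iSup_sum]
      refine iSup_le fun J => ?_
      set S := J.image fun j => (gridCube b j.1 j.2).set with hS
      have hSg : ∀ Q ∈ S, IsGridSet b Q := by
        intro Q hQ
        obtain ⟨j, -, rfl⟩ := Finset.mem_image.1 hQ
        exact ⟨_, _, rfl⟩
      have hcube : ∀ Q ∈ S, ∃ R : Cube n, Q = R.set := fun Q hQ =>
        let ⟨k, N, h⟩ := hSg Q hQ; ⟨_, h⟩
      rw [← Finset.sum_image (g := fun j : ℤ × (Fin n → ℤ) => (gridCube b j.1 j.2).set)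
        (f := fun Q => ENNReal.ofReal (lam α Q) * (∫⁻ x in Q, f x ∂weightMeasure σ) *
          (∫⁻ x in Q, g x ∂weightMeasure u)) (gridCube_injective hn b).injOn]
      refine hbil (weightMeasure σ) (weightMeasure u) S (lam α) (c * D) f g (by positivity) hf hg
        (laminar_of_isGridSet hSg) (fun Q hQ => ?_) (fun Q hQ => ?_) (fun Q hQ => ?_)
        (fun Q hQ => lam_pos_of_isGridSet α (hSg Q hQ)) (hK b S hSg) (fun Q hQ h0 => ?_)
        (fun Q hQ h0 => ?_)
      · obtain ⟨R, rfl⟩ := hcube Q hQ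
        exact R.measurableSet
      · obtain ⟨R, rfl⟩ := hcube Q hQ
        exact hσ.cube_ne_top R
      · obtain ⟨R, rfl⟩ := hcube Q hQ
        exact hu.cube_ne_top R
      · exact (htail₁ hpp.pos hσ hu b S hSg Q hQ h0).trans (scale hq hC₁
          (le_add_of_nonneg_right (by positivity)) (le_self_add.trans hAB))
      · exact (htail₂ hqr.symm.pos hu hσ b S hSg Q hQ h0).trans (scale hp' hC₂
          (le_add_of_nonneg_left (by positivity)) (le_add_self.trans hAB))
    calc _ ≤ _ := lintegral_riesz_mul_le hn hα hσ.1 hf hg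
      _ ≤ ENNReal.ofReal (6 ^ (n - α)) * ∑ b : Fin n → Bool,
          ENNReal.ofReal (C₀ * (c * D)) * (N * M) := by
          gcongr with b _
          exact hgrid b
      _ = _ := by
          have e : ENNReal.ofReal (C * D) =
              ENNReal.ofReal (6 ^ (n - α)) * (2 ^ n * ENNReal.ofReal (C₀ * (c * D))) := by
            rw [hC, show 6 ^ (n - α) * (2 ^ n * (C₀ * c)) * D =
              6 ^ (n - α) * (2 ^ n * (C₀ * (c * D))) by ring,
              ENNReal.ofReal_mul (by positivity), ENNReal.ofReal_mul (by positivity),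
              ENNReal.ofReal_pow (by positivity), ENNReal.ofReal_ofNat]
          rw [Finset.sum_const, Finset.card_univ, nsmul_eq_mul, e]
          simp only [Fintype.card_pi, Fintype.card_bool, Finset.prod_const, Finset.card_univ,
            Fintype.card_fin, Nat.cast_pow, Nat.cast_ofNat]
          ring
  rcases eq_or_ne (A + B) ∞ with htop | htop
  · rw [htop, ENNReal.mul_top (ENNReal.ofReal_pos.2 hC0).ne']
    exact le_top
  · refine ENNReal.le_of_forall_pos_le_add fun ε hε _ => ?_
    have hD : 0 < (A + B).toReal + ε / C := by positivity
    refine (key _ hD ?_).trans_eq ?_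
    · rw [ENNReal.ofReal_add (by positivity) (by positivity), ENNReal.ofReal_toReal htop]
      exact le_self_add
    · rw [mul_add, mul_div_cancel₀ _ hC0.ne', ENNReal.ofReal_add (by positivity) (by positivity),
        ENNReal.ofReal_mul hC0.le, ENNReal.ofReal_toReal htop, ENNReal.ofReal_coe_nnreal]

lemma eucNorm_sub_comm {n : ℕ} (x y : Rn n) : eucNorm (x - y) = eucNorm (y - x) := by
  simp only [eucNorm, Pi.sub_apply]
  congr 1
  exact Finset.sum_congr rfl fun i _ => by ring

lemma measurable_eucNorm {n : ℕ} : Measurable (eucNorm (n := n)) := by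
  unfold eucNorm
  fun_prop

lemma measurable_riesz_kernel {n : ℕ} (α : ℝ) : Measurable fun z : Rn n × Rn n =>
    ENNReal.ofReal (eucNorm (z.1 - z.2) ^ (α - n)) :=
  ((measurable_eucNorm.comp (measurable_fst.sub measurable_snd)).pow_const _).ennreal_ofReal

lemma measurable_riesz {n : ℕ} (α : ℝ) {h : Rn n → ℝ≥0∞} (hh : Measurable h) :
    Measurable (riesz α h) := by
  have hm : Measurable fun z : Rn n × Rn n =>
      h z.2 * ENNReal.ofReal (eucNorm (z.1 - z.2) ^ (α - n)) :=
    (hh.comp measurable_snd).mul (measurable_riesz_kernel α)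
  exact hm.lintegral_prod_right'

lemma lintegral_riesz_mul_comm {n : ℕ} (α : ℝ) {f g : Rn n → ℝ≥0∞}
    (hf : Measurable f) (hg : Measurable g) :
    ∫⁻ x, riesz α f x * g x = ∫⁻ x, riesz α g x * f x := by
  have hk := measurable_riesz_kernel (n := n) α
  have h1 : ∀ {f g : Rn n → ℝ≥0∞}, Measurable f → ∀ x, riesz α f x * g x =
      ∫⁻ y, f y * ENNReal.ofReal (eucNorm (x - y) ^ (α - n)) * g x := by
    intro f g hf x
    have hm : Measurable fun z : Rn n × Rn n =>
        f z.2 * ENNReal.ofReal (eucNorm (z.1 - z.2) ^ (α - n)) :=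
      (hf.comp measurable_snd).mul hk
    have hx : Measurable fun y => f y * ENNReal.ofReal (eucNorm (x - y) ^ (α - n)) :=
      hm.comp (measurable_prodMk_left (x := x))
    rw [riesz, lintegral_mul_const _ hx]
  have hm : Measurable fun z : Rn n × Rn n =>
      f z.2 * ENNReal.ofReal (eucNorm (z.1 - z.2) ^ (α - n)) * g z.1 :=
    ((hf.comp measurable_snd).mul hk).mul (hg.comp measurable_fst)
  calc _ = ∫⁻ x, ∫⁻ y, f y * ENNReal.ofReal (eucNorm (x - y) ^ (α - n)) * g x :=
        lintegral_congr (h1 hf)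
    _ = ∫⁻ y, ∫⁻ x, f y * ENNReal.ofReal (eucNorm (x - y) ^ (α - n)) * g x :=
        lintegral_lintegral_swap hm.aemeasurable
    _ = ∫⁻ y, ∫⁻ x, g x * ENNReal.ofReal (eucNorm (y - x) ^ (α - n)) * f y := by
        refine lintegral_congr fun y => lintegral_congr fun x => ?_
        rw [eucNorm_sub_comm]
        ring
    _ = _ := (lintegral_congr (h1 hg)).symm

lemma riesz_eq_zero_of_LpW_eq_zero {n : ℕ} {α p : ℝ} (hp : 0 < p) {σ : Rn n → ℝ}
    (hσ : Measurable σ) {f : Rn n → ℝ≥0∞} (hf : Measurable f) (h : LpW f p σ = 0) :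
    riesz α (mulW f σ) = 0 := by
  have hm : Measurable fun x => f x ^ p * ENNReal.ofReal (σ x) :=
    (hf.pow_const p).mul hσ.ennreal_ofReal
  rw [LpW, ENNReal.rpow_eq_zero_iff_of_pos (by positivity), lintegral_eq_zero_iff hm] at h
  ext x
  rw [riesz, lintegral_eq_zero_of_ae_eq_zero]
  · rfl
  filter_upwards [h] with y hy
  rcases mul_eq_zero.1 hy with h' | h'
  · rw [ENNReal.rpow_eq_zero_iff_of_pos hp] at h'
    simp [mulW, h']
  · simp [mulW, h']

/-- The Riesz potential is self-adjoint, so the dual two-weight norm is no larger. -/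
lemma opNormStrong_riesz_dual_le {n : ℕ} (α : ℝ) {p q p' r : ℝ} (hpp : p.HolderConjugate p')
    (hqr : q.HolderConjugate r) {u σ : Rn n → ℝ} (hu : Measurable u) (hσ : Measurable σ) :
    opNormStrong (riesz α) r p' u σ ≤ opNormStrong (riesz α) p q σ u := by
  refine opNormStrong_le fun g hg _ => ?_
  rw [LpW_eq hσ]
  refine lintegral_rpow_le_of_forall_pairing hpp.symm fun f hf hft => ?_
  have hfσ : Measurable (mulW f σ) := hf.mul hσ.ennreal_ofReal
  have hgu : Measurable (mulW g u) := hg.mul hu.ennreal_ofReal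
  have hbd := LpW_le_opNormStrong_mul (T := riesz α) (p := p) (q := q) (σ := σ) (u := u) hf
    (by rw [LpW_eq hσ]; exact ENNReal.rpow_ne_top_of_nonneg hpp.one_div_nonneg hft)
    (fun h0 => by
      rw [riesz_eq_zero_of_LpW_eq_zero hpp.pos hσ hf h0, LpW]
      simp [hqr.pos])
  rw [← LpW_eq hσ]
  calc ∫⁻ x, riesz α (mulW g u) x * f x ∂weightMeasure σ
      = ∫⁻ x, riesz α (mulW g u) x * mulW f σ x := by
        rw [lintegral_weightMeasure hσ]
        simp_rw [mulW, mul_assoc]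
    _ = ∫⁻ x, riesz α (mulW f σ) x * mulW g u x := lintegral_riesz_mul_comm α hgu hfσ
    _ = ∫⁻ x, riesz α (mulW f σ) x * g x ∂weightMeasure u := by
        rw [lintegral_weightMeasure hu]
        simp_rw [mulW, mul_assoc]
    _ ≤ LpW (riesz α (mulW f σ)) q u * LpW g r u := by
        rw [LpW_eq hu, LpW_eq hu]
        exact ENNReal.lintegral_mul_le_Lp_mul_Lq _ hqr (measurable_riesz α hfσ).aemeasurable
          hg.aemeasurable
    _ ≤ opNormStrong (riesz α) p q σ u * LpW f p σ * LpW g r u := by gcongr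
    _ = _ := by ring

lemma fracMax_le_riesz {n : ℕ} (hn : 0 < n) {α : ℝ} (hα : α < n) (h : Rn n → ℝ≥0∞) (x : Rn n) :
    fracMax α h x ≤ ENNReal.ofReal (Real.sqrt n ^ (n - α)) * riesz α h x := by
  have : Nonempty (Fin n) := ⟨⟨0, hn⟩⟩
  have hn0 : (0 : ℝ) < n := by positivity
  refine iSup₂_le fun Q hx => ?_
  have hne : ∀ᵐ y ∂volume.restrict Q.set, y ∈ Q.set ∧ x ≠ y := by
    have : ∀ᵐ y : Rn n ∂volume.restrict Q.set, y ∈ ({x} : Set (Rn n))ᶜ :=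
      measure_eq_zero_iff_ae_notMem.1 (measure_singleton x)
    filter_upwards [this, ae_restrict_mem Q.measurableSet] with y hy hyQ
    exact ⟨hyQ, fun hxy => hy hxy.symm⟩
  have hs := Q.side_pos
  have hvol : Q.vol ^ (α / n - 1) = Q.side ^ (α - n) := by
    rw [Cube.vol, ← Real.rpow_natCast, ← Real.rpow_mul hs.le]
    congr 1
    field_simp
  have hkey : ∀ y ∈ Q.set, x ≠ y →
      Q.side ^ (α - n) ≤ Real.sqrt n ^ (n - α) * eucNorm (x - y) ^ (α - n) := by
    intro y hy hxy
    have hpos : 0 < eucNorm (x - y) :=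
      (norm_pos_iff.2 (sub_ne_zero.2 hxy)).trans_le (norm_le_eucNorm _)
    have hle : eucNorm (x - y) ≤ Real.sqrt n * Q.side := by
      rw [eucNorm, Real.sqrt_le_left (by positivity), mul_pow, Real.sq_sqrt hn0.le]
      calc ∑ i, (x - y) i ^ 2 ≤ ∑ _i : Fin n, Q.side ^ 2 := by
            refine Finset.sum_le_sum fun i _ => sq_le_sq' ?_ ?_ <;>
              simp only [Pi.sub_apply] <;> linarith [(hx i).1, (hx i).2, (hy i).1, (hy i).2]
        _ = _ := by simp
    have hsn : 0 < Real.sqrt n := Real.sqrt_pos.2 hn0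
    have := Real.rpow_le_rpow_of_nonpos hpos hle (by linarith : α - n ≤ 0)
    rw [Real.mul_rpow hsn.le hs.le] at this
    calc Q.side ^ (α - n) =
          Real.sqrt n ^ (n - α) * (Real.sqrt n ^ (α - n) * Q.side ^ (α - n)) := by
          rw [← mul_assoc, ← Real.rpow_add hsn]
          simp
      _ ≤ _ := by gcongr
  rw [hvol, riesz, ← lintegral_const_mul' _ _ ENNReal.ofReal_ne_top,
    ← lintegral_const_mul' _ _ ENNReal.ofReal_ne_top]
  refine le_trans (lintegral_mono_ae ?_) (setLIntegral_le_lintegral Q.set _)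
  filter_upwards [hne] with y hy
  calc _ ≤ ENNReal.ofReal (Real.sqrt n ^ (n - α) * eucNorm (x - y) ^ (α - n)) * h y := by
        gcongr
        exact hkey y hy.1 hy.2
    _ = _ := by rw [ENNReal.ofReal_mul (by positivity)]; ring

/-- strong-type part of the fractional Muckenhoupt–Wheeden theorem:
for `0 < α < n` and `1 < p < q < ∞`, the strong `(p,q)` operator norm of `I_α(·σ)` is
comparable to the sum of the strong `(p,q)` norm of `M_α(·σ)` and the strong `(q',p')`
norm of `M_α(·u)`, with constants depending only on `n, α, p, q`. -/
theorem stmt1 (n : ℕ) (hn : 0 < n) (α p q : ℝ) (hα : 0 < α) (hαn : α < n)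
    (hp : 1 < p) (hpq : p < q) :
    ∃ c C : ℝ≥0∞, 0 < c ∧ C < ∞ ∧
      ∀ u σ : Rn n → ℝ, IsWeight u → IsWeight σ →
        c * (opNormStrong (fracMax α) p q σ u +
              opNormStrong (fracMax α) (conjExp q) (conjExp p) u σ) ≤
            opNormStrong (riesz α) p q σ u ∧
          opNormStrong (riesz α) p q σ u ≤
            C * (opNormStrong (fracMax α) p q σ u +
              opNormStrong (fracMax α) (conjExp q) (conjExp p) u σ) := by
  have hpp : p.HolderConjugate (conjExp p) := Real.HolderConjugate.conjExponent hp
  have hqr : q.HolderConjugate (conjExp q) := Real.HolderConjugate.conjExponent (hp.trans hpq)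
  obtain ⟨C, -, hC⟩ := exists_opNormStrong_riesz_le hn hαn hp hpq hpp hqr
  set a := ENNReal.ofReal (Real.sqrt n ^ (n - α)) with ha
  have ha0 : a ≠ 0 := (ENNReal.ofReal_pos.2 (by positivity)).ne'
  have hat : a ≠ ∞ := ENNReal.ofReal_ne_top
  have h2a : 2 * a ≠ ∞ := ENNReal.mul_ne_top ENNReal.ofNat_ne_top hat
  refine ⟨(2 * a)⁻¹, ENNReal.ofReal C, ENNReal.inv_pos.2 h2a, ENNReal.ofReal_lt_top,
    fun u σ hu hσ => ⟨?_, hC u σ hu hσ⟩⟩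
  rw [mul_comm, ← div_eq_mul_inv]
  refine ENNReal.div_le_of_le_mul ?_
  have h1 : opNormStrong (fracMax α) p q σ u ≤ a * opNormStrong (riesz α) p q σ u :=
    opNormStrong_mono hqr.pos hat (fracMax_le_riesz hn hαn)
  have h2 : opNormStrong (fracMax α) (conjExp q) (conjExp p) u σ ≤
      a * opNormStrong (riesz α) (conjExp q) (conjExp p) u σ :=
    opNormStrong_mono hpp.symm.pos hat (fracMax_le_riesz hn hαn)
  calc _ ≤ a * opNormStrong (riesz α) p q σ u + a * opNormStrong (riesz α) p q σ u :=
        add_le_add h1 (h2.trans (mul_le_mul_right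
          (opNormStrong_riesz_dual_le α hpp hqr hu.1 hσ.1) a))
    _ = _ := by ring
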